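/- Let q be a prime power whose characteristic p satisfies p ≥ 4 (equivalently p ≥ 5). If q > 3.29 × 10^{32}, then 𝔽_q contains 4 consecutive primitive elements. -/

import Mathlib

open Finset

/-- An element `g` of a finite field is primitive if it generates the multiplicative
group of nonzero elements, i.e. every nonzero element is a power of `g`. -/
def IsPrimitiveElem {F : Type*} [Field F] (g : F) : Prop :=
  ∀ x : F, x ≠ 0 → ∃ k : ℕ, g ^ k = x

/-- The field `F` contains `n` consecutive distinct primitive elements: there is `g`
such that `g, g+1, …, g+n-1` are `n` distinct primitive elements. -/
def HasConsecutivePrimitives (F : Type*) [Field F] (n : ℕ) : Prop :=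
  ∃ g : F, (∀ k : ℕ, k < n → IsPrimitiveElem (g + (k : F))) ∧
    ∀ i : ℕ, i < n → ∀ j : ℕ, j < n → g + (i : F) = g + (j : F) → i = j

/-- If `b ^ t` is a `d`-th power only when `d ∣ t`, then a `d`-th root of `b` has degree at least
`d` over the base field. -/
theorem le_natDegree_minpoly_of_pow_eq {K L : Type*} [Field K] [Field L] [Algebra K L]
    [IsAlgClosed L] {d : ℕ} (hd : 0 < d) {b : K} (hb : ∀ t : ℕ, ∀ a : K, a ^ d = b ^ t → d ∣ t)
    {y : L} (hy : y ^ d = algebraMap K L b) : d ≤ (minpoly K y).natDegree := by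
  have hy_int : IsIntegral K y := by
    refine ⟨Polynomial.X ^ d - Polynomial.C b, Polynomial.monic_X_pow_sub_C b hd.ne', ?_⟩
    simp [hy]
  have hdvd : minpoly K y ∣ Polynomial.X ^ d - Polynomial.C b :=
    minpoly.dvd K y (by simp [hy])
  have hmonic := minpoly.monic hy_int
  set m := minpoly K y with hm
  have hroots : ∀ z ∈ (m.map (algebraMap K L)).roots, z ^ d = algebraMap K L b := by
    intro z hz
    have h1 : Polynomial.aeval z m = 0 := by
      have := Polynomial.isRoot_of_mem_roots hz
      rwa [Polynomial.IsRoot, Polynomial.eval_map_algebraMap] at this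
    have h2 : Polynomial.aeval z (Polynomial.X ^ d - Polynomial.C b) = 0 := by
      obtain ⟨s, hs⟩ := hdvd
      rw [hs, map_mul, h1, zero_mul]
    simpa [sub_eq_zero] using h2
  have hsplit : (m.map (algebraMap K L)).Splits := IsAlgClosed.splits _
  have hcard : (m.map (algebraMap K L)).roots.card = m.natDegree := by
    rw [← hsplit.natDegree_eq_card_roots, Polynomial.natDegree_map]
  have hprod : (m.map (algebraMap K L)).roots.prod ^ d = algebraMap K L b ^ m.natDegree := by
    have h := Multiset.prod_map_pow (m := (m.map (algebraMap K L)).roots) (f := id) (n := d)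
    simp only [id, Multiset.map_id'] at h
    rw [← h, Multiset.map_congr rfl hroots]
    simp [hcard]
  have hcoeff := hsplit.coeff_zero_eq_prod_roots_of_monic (hmonic.map _)
  rw [Polynomial.natDegree_map, Polynomial.coeff_map] at hcoeff
  have h3 : ((-1) ^ m.natDegree * m.coeff 0) ^ d = b ^ m.natDegree := by
    apply (algebraMap K L).injective
    rw [map_pow, map_mul, hcoeff, ← mul_assoc, map_pow, map_neg, map_one, ← mul_pow]
    simp [hprod]
  exact Nat.le_of_dvd (minpoly.natDegree_pos hy_int) (hb _ _ h3)

/-- The matrix of multiplication by `f * ∑ u j * Y ^ j` in the basis `1, Y, …, Y ^ (d - 1)`,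
where `f * Y ^ d = c`. -/
def twistedCirculant {R : Type*} [CommRing R] {d : ℕ} (f c : R) (u : Fin d → R) :
    Matrix (Fin d) (Fin d) R :=
  Matrix.of fun i l => if i ≤ l then f * u (l - i) else c * u (l - i)

theorem twistedCirculant_mulVec {R : Type*} [CommRing R] {d : ℕ} (f c : R) (u : Fin d → R)
    {Y : R} (hY : f * Y ^ d = c) :
    (twistedCirculant f c u).mulVec (fun l => Y ^ (l : ℕ)) =
      fun i : Fin d => f * Y ^ (i : ℕ) * ∑ j, u j * Y ^ (j : ℕ) := by
  funext i
  have : NeZero d := ⟨by have := i.2; omega⟩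
  have hshift := Equiv.sum_comp (Equiv.subRight i) fun j : Fin d => u j * Y ^ (j : ℕ)
  simp only [Equiv.subRight_apply] at hshift
  rw [Matrix.mulVec, dotProduct, ← hshift, mul_sum]
  refine sum_congr rfl fun l _ => ?_
  simp only [twistedCirculant, Matrix.of_apply]
  split_ifs with h
  · have h1 : ((l - i : Fin d) : ℕ) = l - i := Fin.sub_val_of_le h
    have h2 : Y ^ (l : ℕ) = Y ^ (i : ℕ) * Y ^ ((l - i : Fin d) : ℕ) := by
      rw [← pow_add, h1]
      congr 1
      have : (i : ℕ) ≤ l := h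
      omega
    rw [h2]; ring
  · have h1 : ((l - i : Fin d) : ℕ) = d + l - i := by
      have := Fin.coe_sub_iff_lt.mpr (not_le.mp h)
      exact this
    have h2 : Y ^ (i : ℕ) * Y ^ ((l - i : Fin d) : ℕ) = Y ^ d * Y ^ (l : ℕ) := by
      rw [← pow_add, ← pow_add, h1]
      congr 1
      have := i.2
      omega
    calc c * u (l - i) * Y ^ (l : ℕ) = f * u (l - i) * (Y ^ d * Y ^ (l : ℕ)) := by rw [← hY]; ring
      _ = _ := by rw [← h2]; ring

theorem twistedCirculant_map {R S : Type*} [CommRing R] [CommRing S] (φ : R →+* S) {d : ℕ}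
    (f c : R) (u : Fin d → R) :
    (twistedCirculant f c u).map φ = twistedCirculant (φ f) (φ c) (fun j => φ (u j)) := by
  ext i l
  simp only [twistedCirculant, Matrix.map_apply, Matrix.of_apply]
  split_ifs <;> simp

open Polynomial in
theorem natDegree_det_le_of_natDegree_le {R : Type*} [CommRing R] {d B : ℕ}
    (M : Matrix (Fin d) (Fin d) R[X]) (hM : ∀ i j, (M i j).natDegree ≤ B) :
    M.det.natDegree ≤ d * B := by
  rw [Matrix.det_apply]
  refine natDegree_sum_le_of_forall_le _ _ fun σ _ => ?_
  refine (natDegree_smul_le _ _).trans ?_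
  refine (natDegree_prod_le _ _).trans ?_
  refine (sum_le_sum fun i _ => hM _ _).trans ?_
  simp

open Polynomial in
/-- A nonzero combination of `1, G, …, G ^ (d - 1)` with coefficients of small degree
is not divisible by a high power of a linear polynomial, when `f * G ^ d` is nearly constant
and `f` is far from being a power. -/
theorem eq_zero_of_pow_dvd_sum {k : Type*} [Field k] {d : ℕ} (hd : 0 < d) {f : k[X]} (hf0 : f ≠ 0)
    (hf : ∀ t : ℕ, ∀ P Q : k[X], ∀ e : k, e ≠ 0 → Q ≠ 0 → f ^ t * P ^ d = C e * Q ^ d → d ∣ t)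
    {A r : ℕ} {x₀ c : k} (hc : c ≠ 0) {G : k[X]} (hG : (X - C x₀) ^ r ∣ f * G ^ d - C c)
    (hr : d * (A + f.natDegree) < r) {u : Fin d → k[X]} (hu : ∀ j, (u j).natDegree ≤ A)
    (hdvd : (X - C x₀) ^ r ∣ ∑ j, u j * G ^ (j : ℕ)) : u = 0 := by
  classical
  set M := twistedCirculant f (C c) u with hM
  have hdetdeg : M.det.natDegree ≤ d * (A + f.natDegree) := by
    refine natDegree_det_le_of_natDegree_le _ fun i j => ?_
    simp only [hM, twistedCirculant, Matrix.of_apply]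
    split_ifs
    · exact natDegree_mul_le.trans (by have := hu (j - i); omega)
    · exact natDegree_mul_le.trans (by have := hu (j - i); simp; omega)
  have hdet : M.det = 0 := by
    have hdvd' : (X - C x₀) ^ r ∣ M.det := by
      rw [← Ideal.mem_span_singleton, ← Ideal.Quotient.eq_zero_iff_mem]
      set φ := Ideal.Quotient.mk (Ideal.span {(X - C x₀) ^ r})
      have hY : φ f * φ G ^ d = φ (C c) := by
        rw [← map_pow, ← map_mul, ← sub_eq_zero, ← map_sub, Ideal.Quotient.eq_zero_iff_mem,
          Ideal.mem_span_singleton]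
        exact hG
      have h0 : ∑ j, φ (u j) * φ G ^ (j : ℕ) = 0 := by
        have : φ (∑ j, u j * G ^ (j : ℕ)) = 0 := by
          rw [Ideal.Quotient.eq_zero_iff_mem, Ideal.mem_span_singleton]
          exact hdvd
        simpa using this
      have hmv := twistedCirculant_mulVec (φ f) (φ (C c)) (fun j => φ (u j)) hY
      rw [h0] at hmv
      simp only [mul_zero] at hmv
      rw [RingHom.map_det]
      change (M.map φ).det = 0
      rw [hM, twistedCirculant_map]
      set N := twistedCirculant (φ f) (φ (C c)) (fun j => φ (u j))
      have h1 : (N.adjugate * N).mulVec (fun l => φ G ^ (l : ℕ)) = 0 := by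
        rw [← Matrix.mulVec_mulVec, hmv]
        exact Matrix.mulVec_zero _
      rw [Matrix.adjugate_mul, Matrix.smul_mulVec, Matrix.one_mulVec] at h1
      have := congr_fun h1 ⟨0, hd⟩
      simpa using this
    by_contra hne
    have h1 := natDegree_le_of_dvd hdvd' hne
    rw [natDegree_pow, natDegree_X_sub_C] at h1
    omega
  obtain ⟨w, hw0, hw⟩ := Matrix.exists_vecMul_eq_zero_iff.mpr hdet
  let K := FractionRing k[X]
  let L := AlgebraicClosure K
  have hinjK : Function.Injective (algebraMap k[X] K) := IsFractionRing.injective _ _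
  have hinj : Function.Injective (algebraMap k[X] L) := by
    rw [IsScalarTower.algebraMap_eq k[X] K L]
    exact (algebraMap K L).injective.comp hinjK
  have hfK : algebraMap k[X] K f ≠ 0 := by
    rwa [Ne, map_eq_zero_iff _ hinjK]
  let b : K := algebraMap k[X] K (C c) / algebraMap k[X] K f
  obtain ⟨y, hy⟩ := IsAlgClosed.exists_pow_nat_eq (algebraMap K L b) hd
  have hb : ∀ t : ℕ, ∀ a : K, a ^ d = b ^ t → d ∣ t := by
    intro t a ha
    obtain ⟨P, Q, hQ, rfl⟩ := IsFractionRing.div_surjective (A := k[X]) a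
    have hQ0 : Q ≠ 0 := nonZeroDivisors.ne_zero hQ
    have hQK : algebraMap k[X] K Q ≠ 0 := by rwa [Ne, map_eq_zero_iff _ hinjK]
    refine hf t P Q (c ^ t) (pow_ne_zero _ hc) hQ0 ?_
    apply hinjK
    simp only [b] at ha
    rw [div_pow, div_pow, div_eq_div_iff (pow_ne_zero _ hQK) (pow_ne_zero _ hfK)] at ha
    simp only [map_mul, map_pow]
    rw [mul_comm, ha]
  have hdeg := le_natDegree_minpoly_of_pow_eq hd hb hy
  have hindep : ∀ v : Fin d → k[X],
      ∑ j, algebraMap k[X] L (v j) * y ^ (j : ℕ) = 0 → v = 0 := by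
    intro v hv
    set q : K[X] := ∑ j : Fin d, C (algebraMap k[X] K (v j)) * X ^ (j : ℕ) with hq
    have hq0 : q = 0 := by
      by_contra hne
      have h1 : aeval y q = 0 := by
        rw [hq]
        simpa [← IsScalarTower.algebraMap_apply] using hv
      have h2 := natDegree_le_natDegree (minpoly.degree_le_of_ne_zero K y hne h1)
      have h3 : q.natDegree < d := by
        rw [natDegree_lt_iff_degree_lt hne]
        refine (degree_sum_le _ _).trans_lt ?_
        rw [Finset.sup_lt_iff (by exact_mod_cast WithBot.bot_lt_coe d)]
        intro j _
        refine (degree_C_mul_X_pow_le _ _).trans_lt ?_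
        exact_mod_cast j.2
      omega
    funext j
    apply hinjK
    have : q.coeff j = algebraMap k[X] K (v j) := by
      rw [hq, finsetSum_coeff]
      simp only [coeff_C_mul_X_pow]
      rw [Finset.sum_eq_single j]
      · simp
      · intro i _ hij
        rw [if_neg (fun h => hij (Fin.ext h.symm))]
      · simp
    rw [← this, hq0]
    simp
  have hyf : algebraMap k[X] L f * y ^ d = algebraMap k[X] L (C c) := by
    rw [hy, IsScalarTower.algebraMap_apply k[X] K L, IsScalarTower.algebraMap_apply k[X] K L,
      ← map_mul]
    congr 1
    exact mul_div_cancel₀ _ hfK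
  have hmv := twistedCirculant_mulVec (algebraMap k[X] L f) (algebraMap k[X] L (C c))
    (fun j => algebraMap k[X] L (u j)) hyf
  rw [← twistedCirculant_map, ← hM] at hmv
  have h1 : (fun i => algebraMap k[X] L (w i)) ⬝ᵥ
      ((M.map (algebraMap k[X] L)).mulVec fun l => y ^ (l : ℕ)) = 0 := by
    rw [Matrix.dotProduct_mulVec]
    have : Matrix.vecMul (fun i => algebraMap k[X] L (w i)) (M.map (algebraMap k[X] L)) =
        fun i => algebraMap k[X] L (Matrix.vecMul w M i) := by
      funext i
      simp [Matrix.vecMul, dotProduct]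
    rw [this, hw]
    simp
  rw [hmv, dotProduct] at h1
  have h2 : algebraMap k[X] L f * (∑ i, algebraMap k[X] L (w i) * y ^ (i : ℕ)) *
      (∑ j, algebraMap k[X] L (u j) * y ^ (j : ℕ)) = 0 := by
    rw [← h1, mul_assoc, sum_mul, mul_sum]
    exact sum_congr rfl fun i _ => by ring
  rcases mul_eq_zero.mp h2 with h3 | h3
  · rcases mul_eq_zero.mp h3 with h4 | h4
    · exact absurd ((map_eq_zero_iff _ hinj).mp h4) hf0
    · exact absurd (hindep w h4) hw0
  · exact hindep u h3

open Polynomial in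
theorem exists_ne_zero_sum_C_mul_eq_zero {k ι : Type*} [Field k] [Fintype ι] {N : ℕ}
    (B : ι → k[X]) (hB : ∀ i, (B i).natDegree < N) (h : N < Fintype.card ι) :
    ∃ v : ι → k, v ≠ 0 ∧ ∑ i, C (v i) * B i = 0 := by
  let T : (ι → k) →ₗ[k] (Fin N → k) :=
    LinearMap.pi fun n => ∑ i, ((B i).coeff n) • LinearMap.proj i
  have hker : LinearMap.ker T ≠ ⊥ := LinearMap.ker_ne_bot_of_finrank_lt (by simpa using h)
  obtain ⟨v, hv, hv0⟩ := Submodule.exists_mem_ne_zero_of_ne_bot hker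
  refine ⟨v, hv0, ?_⟩
  ext n
  rw [finsetSum_coeff, coeff_zero]
  simp only [coeff_C_mul]
  by_cases hn : n < N
  · have := congr_fun (LinearMap.mem_ker.mp hv) ⟨n, hn⟩
    simp only [T, LinearMap.pi_apply, LinearMap.sum_apply, LinearMap.smul_apply,
      LinearMap.proj_apply, smul_eq_mul, Pi.zero_apply] at this
    rw [← this]
    exact sum_congr rfl fun i _ => mul_comm _ _
  · refine sum_eq_zero fun i _ => ?_
    rw [coeff_eq_zero_of_natDegree_lt ((hB i).trans_le (not_lt.mp hn)), mul_zero]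

theorem dvd_of_sum_pow_mul_eq_zero {R : Type*} [CommRing R] [IsDomain R] {M : ℕ} {π : R}
    (hπ : π ≠ 0) (V : Fin M → R) (h : ∑ i : Fin M, π ^ (i : ℕ) * V i = 0) (m : Fin M)
    (hV : ∀ i < m, V i = 0) : π ∣ V m := by
  have h1 : π ^ ((m : ℕ) + 1) ∣ π ^ (m : ℕ) * V m := by
    rw [← add_sum_erase _ _ (mem_univ m), add_eq_zero_iff_eq_neg] at h
    rw [h, dvd_neg]
    refine dvd_sum fun i hi => ?_
    rcases lt_or_ge i m with him | him
    · rw [hV i him, mul_zero]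
      exact dvd_zero _
    · have : m < i := lt_of_le_of_ne him (ne_of_mem_erase hi).symm
      exact Dvd.dvd.mul_right (pow_dvd_pow _ this) _
  rw [pow_succ] at h1
  exact (mul_dvd_mul_iff_left (pow_ne_zero _ hπ)).mp h1

open Polynomial in
/-- The Stepanov–Bombieri bound: over the field with `r ^ 2` elements, a polynomial takes values
in a given coset of the `d`-th powers at most about `r ^ 2 / d` times. -/
theorem card_mul_le_of_eval_pow_eq {k : Type*} [Field k] [IsAlgClosed k] {p : ℕ} [ExpChar k p]
    {d : ℕ} (hd : 1 < d) {f : k[X]} (hf0 : f ≠ 0)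
    (hf : ∀ t : ℕ, ∀ P Q : k[X], ∀ e : k, e ≠ 0 → Q ≠ 0 → f ^ t * P ^ d = C e * Q ^ d → d ∣ t)
    {r r' s : ℕ} (hrp : r = p ^ s) (hr : r = d * r' + 1)
    (hr' : d * f.natDegree * (f.natDegree + 1) + f.natDegree < r')
    {ζ : k} (hζ : ζ ≠ 0) (Z : Finset k)
    (hZ : ∀ x ∈ Z, x ^ (r * r) = x ∧ f.eval x ^ (r' * (r + 1)) = ζ) :
    d * Z.card ≤ r * r + (2 * d * f.natDegree + 1) * r := by
  have hd0 : 0 < d := by omega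
  set D := f.natDegree with hD
  have hfrob : ∀ {ι : Type} (s' : Finset ι) (g : ι → k),
      (∑ i ∈ s', g i) ^ r = ∑ i ∈ s', g i ^ r := by
    intro ι s' g
    rw [hrp]
    exact sum_pow_char_pow p s s' g
  have hfrobsub : ∀ a b : k, (a - b) ^ r = a ^ r - b ^ r := by
    intro a b; rw [hrp]; exact sub_pow_expChar_pow a b s
  have hfrobsubP : ∀ a b : k[X], (a - b) ^ r = a ^ r - b ^ r := by
    intro a b; rw [hrp]; exact sub_pow_expChar_pow a b s
  obtain ⟨x₀, hx₀⟩ : ∃ x₀, f.eval x₀ ≠ 0 := by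
    by_contra! h
    exact hf0 (Polynomial.funext fun x => by simp [h x])
  obtain ⟨A, hA⟩ : ∃ A, r' = A + D + 1 := ⟨r' - D - 1, by omega⟩
  set M := r' + D + 1 with hM
  set G := f ^ r' with hGdef
  have hGdeg : G.natDegree ≤ r' * D := natDegree_pow_le
  set c₀ := x₀ ^ (r * r) with hc₀
  let I := Fin d × Fin M × Fin (A + 1)
  let B : I → k[X] := fun i =>
    C (ζ ^ (i.1 : ℕ)) * X ^ (r * (i.2.2 : ℕ)) * (X - C c₀) ^ (i.2.1 : ℕ) * G ^ (d - 1 - (i.1 : ℕ))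
  have hBdeg : ∀ i, (B i).natDegree < r * A + M + (d - 1) * (r' * D) := by
    rintro ⟨j, m, a⟩
    have h1 : (B (j, m, a)).natDegree ≤
        (0 + r * (a : ℕ)) + (m : ℕ) * 1 + (d - 1 - (j : ℕ)) * (r' * D) := by
      refine natDegree_mul_le_of_le (natDegree_mul_le_of_le (natDegree_mul_le_of_le ?_ ?_) ?_) ?_
      · simp
      · simp
      · exact natDegree_pow_le_of_le _ (natDegree_X_sub_C_le _)
      · exact natDegree_pow_le_of_le _ hGdeg
    have h2 : r * (a : ℕ) ≤ r * A := Nat.mul_le_mul_left _ (by have := a.2; omega)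
    have h3 : (d - 1 - (j : ℕ)) * (r' * D) ≤ (d - 1) * (r' * D) :=
      Nat.mul_le_mul_right _ (Nat.sub_le _ _)
    have := m.2
    omega
  have hcard : r * A + M + (d - 1) * (r' * D) < Fintype.card I := by
    simp only [I, Fintype.card_prod, Fintype.card_fin]
    obtain ⟨d', rfl⟩ : ∃ d', d = d' + 2 := ⟨d - 2, by omega⟩
    have : d' + 2 - 1 = d' + 1 := rfl
    rw [this, hr, hM]
    have h5 : r' - D = A + 1 := by omega
    zify at hA hr' ⊢
    have hA' : (A : ℤ) = r' - D - 1 := by linarith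
    rw [hA']
    have h6 : (0 : ℤ) ≤ r' := by positivity
    have h7 : (0 : ℤ) ≤ D := by positivity
    have h8 : (0 : ℤ) ≤ d' := by positivity
    nlinarith [mul_nonneg h6 h7, mul_nonneg h6 h8]
  obtain ⟨v, hv0, hv⟩ := exists_ne_zero_sum_C_mul_eq_zero B hBdeg hcard
  have hr0 : 0 < r := by omega
  choose u hu using fun i => IsAlgClosed.exists_pow_nat_eq (v i) hr0
  let U : Fin d → Fin M → k[X] := fun j m => ∑ a : Fin (A + 1), C (u (j, m, a)) * X ^ (a : ℕ)
  have hUdeg : ∀ j m, (U j m).natDegree ≤ A := by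
    intro j m
    refine natDegree_sum_le_of_forall_le _ _ fun a _ => ?_
    exact (natDegree_C_mul_X_pow_le _ _).trans (by have := a.2; omega)
  have hU0 : (∀ m, (fun j => U j m) = 0) → False := by
    intro h
    apply hv0
    funext ⟨j, m, a⟩
    have h1 : (U j m).coeff a = u (j, m, a) := by
      simp only [U, finsetSum_coeff, coeff_C_mul_X_pow]
      rw [Finset.sum_eq_single a]
      · simp
      · intro b _ hb
        rw [if_neg (fun h => hb (Fin.ext h.symm))]
      · simp
    rw [← hu, ← h1, show U j m = 0 from congr_fun (h m) j]
    simp [hr0.ne']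
  let H : k[X] := ∑ m : Fin M, ((X - C x₀) ^ r) ^ (m : ℕ) * ∑ j : Fin d, U j m * G ^ (j : ℕ)
  have hG : (X - C x₀) ^ r ∣ f * G ^ d - C (f.eval x₀ ^ r) := by
    have : f * G ^ d - C (f.eval x₀ ^ r) = (f - C (f.eval x₀)) ^ r := by
      rw [hfrobsubP, C_pow, hGdef, ← pow_mul, ← pow_succ']
      congr 2
      rw [hr]; ring
    rw [this]
    exact pow_dvd_pow_of_dvd (X_sub_C_dvd_sub_C_eval) _
  have hH0 : H ≠ 0 := by
    intro hH
    apply hU0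
    intro m
    induction m using WellFoundedLT.induction with
    | _ m ih =>
      have hdvd := dvd_of_sum_pow_mul_eq_zero (pow_ne_zero r (X_sub_C_ne_zero x₀)) _ hH m (by
        intro i hi
        have := ih i hi
        refine sum_eq_zero fun j _ => ?_
        rw [show U j i = 0 from congr_fun this j, zero_mul])
      refine eq_zero_of_pow_dvd_sum hd0 hf0 hf (pow_ne_zero r hx₀) hG ?_ (fun j => hUdeg j m) hdvd
      have : A + D ≤ r' := by omega
      calc d * (A + D) ≤ d * r' := Nat.mul_le_mul_left _ this
        _ < r := by omega
  have hHdeg : H.natDegree ≤ r * (r' + D) + (A + (d - 1) * (r' * D)) := by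
    refine natDegree_sum_le_of_forall_le _ _ fun m _ => ?_
    refine natDegree_mul_le_of_le ?_ (natDegree_sum_le_of_forall_le _ _ fun j _ => ?_)
    · refine (natDegree_pow_le_of_le _ (natDegree_pow_le_of_le _ (natDegree_X_sub_C_le _))).trans ?_
      rw [mul_one, mul_comm]
      exact Nat.mul_le_mul_left _ (by have := m.2; omega)
    · refine natDegree_mul_le_of_le (hUdeg j m) ((natDegree_pow_le_of_le _ hGdeg).trans ?_)
      exact Nat.mul_le_mul_right _ (by have := j.2; omega)
  have hroot : ∀ x ∈ Z, H.eval x = 0 := by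
    intro x hx
    obtain ⟨hx1, hx2⟩ := hZ x hx
    set g := G.eval x with hg
    have hgζ : g ^ (r + 1) = ζ := by rw [hg, hGdef, eval_pow, ← pow_mul, hx2]
    have hg0 : g ≠ 0 := by
      rintro h
      rw [h, zero_pow (by omega)] at hgζ
      exact hζ hgζ.symm
    have hUr : ∀ j m, (U j m).eval x ^ r = ∑ a : Fin (A + 1), v (j, m, a) * x ^ (r * (a : ℕ)) := by
      intro j m
      simp only [U, eval_finsetSum, eval_mul, eval_C, eval_pow, eval_X]
      rw [hfrob]
      refine sum_congr rfl fun a _ => ?_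
      rw [mul_pow, hu, ← pow_mul, mul_comm r]
    have hlin : ((x - x₀) ^ r) ^ r = x - c₀ := by
      rw [hfrobsub, hfrobsub, ← pow_mul, ← pow_mul, hx1]
    have hE := congr_arg (eval x) hv
    rw [eval_finsetSum, eval_zero] at hE
    simp only [B, I, eval_mul, eval_C, eval_pow, eval_X, eval_sub, Fintype.sum_prod_type] at hE
    have hkey : H.eval x ^ r * g ^ (d - 1) = 0 := by
      rw [← hE]
      simp only [H, eval_finsetSum, eval_mul, eval_C, eval_pow, eval_X, eval_sub]
      rw [hfrob, sum_mul, sum_comm]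
      refine sum_congr rfl fun m _ => ?_
      rw [mul_pow, ← pow_mul, mul_comm (m : ℕ) r, pow_mul, hlin, hfrob, mul_sum, sum_mul]
      refine sum_congr rfl fun j _ => ?_
      rw [mul_pow, hUr, sum_mul, mul_sum, sum_mul]
      refine sum_congr rfl fun a _ => ?_
      have h1 : (g ^ (j : ℕ)) ^ r * g ^ (d - 1) = ζ ^ (j : ℕ) * g ^ (d - 1 - (j : ℕ)) := by
        rw [← hgζ, ← pow_mul, ← pow_mul, ← pow_add, ← pow_add]
        congr 1
        have := j.2
        have h2 : (r + 1) * (j : ℕ) = j * r + j := by ring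
        omega
      rw [← hg]
      linear_combination (x - c₀) ^ (m : ℕ) * v (j, m, a) * x ^ (r * (a : ℕ)) * h1
    have := (mul_eq_zero.mp hkey).resolve_right (pow_ne_zero _ hg0)
    exact pow_eq_zero_iff hr0.ne' |>.mp this
  have hZcard : Z.card ≤ H.natDegree := by
    refine card_le_degree_of_subset_roots fun x hx => ?_
    rw [mem_roots hH0]
    exact hroot x hx
  have hfin := Nat.mul_le_mul_left d (hZcard.trans hHdeg)
  refine hfin.trans ?_
  have e1 : d * r' ≤ r := by omega
  have e2 : d * A ≤ r := (Nat.mul_le_mul_left d (by omega : A ≤ r')).trans e1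
  have e3 : d * ((d - 1) * (r' * D)) ≤ d * D * r := by
    calc d * ((d - 1) * (r' * D)) = (d - 1) * D * (d * r') := by ring
      _ ≤ d * D * r := by
        gcongr
        omega
  have e4 : d * (r * (r' + D)) = (d * r') * r + d * D * r := by ring
  have e5 : (d * r') * r ≤ r * r := Nat.mul_le_mul_right _ e1
  have e6 : (2 * d * D + 1) * r = d * D * r + d * D * r + r := by ring
  rw [mul_add, e4, mul_add, e6]
  omega

open Polynomial in
theorem dvd_mul_of_prod_linear_pow_mul_pow_eq {k ι : Type*} [Field k] [Fintype ι]
    {a : ι → k} (ha : Function.Injective a) (e : ι → ℕ) {d t : ℕ} {P Q : k[X]} {c : k}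
    (hc : c ≠ 0) (hQ : Q ≠ 0) (h : (∏ i, (C (a i) - X) ^ e i) ^ t * P ^ d = C c * Q ^ d) (i : ι) :
    d ∣ t * e i := by
  classical
  have hR : C c * Q ^ d ≠ 0 := mul_ne_zero (C_ne_zero.mpr hc) (pow_ne_zero _ hQ)
  have hlin : ∀ j, C (a j) - X ≠ 0 := fun j => by
    rw [← neg_sub]; exact neg_ne_zero.mpr (X_sub_C_ne_zero _)
  have hmult : ∀ j, rootMultiplicity (a i) (C (a j) - X) = if j = i then 1 else 0 := by
    intro j
    rw [← count_roots, ← neg_sub, roots_neg, roots_X_sub_C, Multiset.count_singleton]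
    simp [ha.eq_iff, eq_comm]
  have h1 := congr_arg (rootMultiplicity (a i)) h
  rw [rootMultiplicity_mul hR, rootMultiplicity_mul (h ▸ hR), rootMultiplicity_C] at h1
  simp only [← count_roots, roots_pow, Multiset.count_nsmul, zero_add] at h1
  rw [roots_prod _ _ (prod_ne_zero_iff.mpr fun j _ => pow_ne_zero _ (hlin j))] at h1
  simp only [Multiset.count_bind, roots_pow, Multiset.count_nsmul, count_roots, hmult] at h1
  have h2 : (Multiset.map (fun j => e j * if j = i then 1 else 0) univ.val).sum = e i := by
    change ∑ j, (e j * if j = i then 1 else 0) = e i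
    simp
  rw [h2] at h1
  exact (Nat.dvd_add_iff_left (dvd_mul_right d _)).mpr (h1 ▸ dvd_mul_right d _)

theorem MulChar.exists_pow_eq_of_orderOf_eq_card {F : Type*} [Field F] [Fintype F]
    {ψ : MulChar F ℂ} (hψ : orderOf ψ = Fintype.card F - 1) (χ : MulChar F ℂ) :
    ∃ e : ℕ, 0 < e ∧ ψ ^ e = χ := by
  classical
  have hcard : Nat.card (MulChar F ℂ) = orderOf ψ := by
    rw [MulChar.card_eq_card_units_of_hasEnoughRootsOfUnity, Nat.card_eq_fintype_card,
      Fintype.card_units, hψ]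
  have hmem : χ ∈ Submonoid.powers ψ := by
    have htop := Subgroup.eq_top_of_card_eq (Subgroup.zpowers ψ) (by rw [Nat.card_zpowers, hcard])
    rw [mem_powers_iff_mem_zpowers, htop]
    trivial
  obtain ⟨e, he⟩ := hmem
  refine ⟨e + orderOf ψ, Nat.add_pos_right _ (orderOf_pos ψ), ?_⟩
  rw [pow_add, pow_orderOf_eq_one, mul_one]
  exact he

theorem MulChar.exists_orderOf_eq_card_sub_one (F : Type*) [Field F] [Fintype F] :
    ∃ ψ : MulChar F ℂ, orderOf ψ = Fintype.card F - 1 := by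
  classical
  obtain ⟨ψ, hψ⟩ := MulChar.exists_mulChar_orderOf_eq_card_units (F := F)
    (Complex.isPrimitiveRoot_exp (Fintype.card Fˣ) Fintype.card_ne_zero)
  exact ⟨ψ, by rw [hψ, Fintype.card_units]⟩

/-- If each `ζ` in the `d`-torsion is taken at most `B / d` times, where `B` is slightly more than
the total number of points, then the sum of a nontrivial character is small. -/
theorem norm_sum_mulChar_le_of_card_fiber_le {F α : Type*} [Field F] [Fintype F] [DecidableEq F]
    [Fintype α] (ψ : MulChar F ℂ) {d : ℕ} (hd : 0 < d) (hψ : ∃ z : F, z ^ d = 1 ∧ ψ z ≠ 1)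
    (y : α → F) (hy : ∀ x, y x = 0 ∨ y x ^ d = 1) {B n : ℝ}
    (hB : ∀ ζ : F, ζ ≠ 0 → d * ((univ.filter fun x => y x = ζ).card : ℝ) ≤ B)
    (hn : ((univ.filter fun x => y x = 0).card : ℝ) ≤ n) (hB0 : 0 ≤ B) :
    ‖∑ x, ψ (y x)‖ ≤ B - Fintype.card α + n := by
  set μ : Finset F := univ.filter fun z => z ^ d = 1 with hμ
  have hd' : (0 : ℝ) < d := by exact_mod_cast hd
  have hne : ∀ z ∈ μ, z ≠ 0 := by
    rintro z hz rfl
    rw [hμ, mem_filter, zero_pow hd.ne'] at hz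
    exact zero_ne_one hz.2
  have hμcard : (μ.card : ℝ) ≤ d := by
    have h1 : μ ⊆ Polynomial.nthRootsFinset d (1 : F) := by
      intro z hz
      rw [Polynomial.mem_nthRootsFinset hd]
      exact (mem_filter.mp hz).2
    have h2 : (Polynomial.nthRootsFinset d (1 : F)).card ≤ d := by
      rw [Polynomial.nthRootsFinset_def]
      exact (Multiset.toFinset_card_le _).trans (Polynomial.card_nthRoots d 1)
    exact_mod_cast (card_le_card h1).trans h2
  have hsum0 : ∑ z ∈ μ, ψ z = 0 := by
    obtain ⟨z₀, hz₀, hψz₀⟩ := hψ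
    have hz₀0 : z₀ ≠ 0 := by
      rintro rfl
      rw [zero_pow hd.ne'] at hz₀
      exact zero_ne_one hz₀
    have h1 : ψ z₀ * ∑ z ∈ μ, ψ z = ∑ z ∈ μ, ψ z := by
      rw [mul_sum]
      refine sum_bij' (fun z _ => z₀ * z) (fun z _ => z₀⁻¹ * z) ?_ ?_ ?_ ?_ ?_
      · intro z hz
        simp only [hμ, mem_filter, mem_univ, true_and] at hz ⊢
        rw [mul_pow, hz, hz₀, one_mul]
      · intro z hz
        simp only [hμ, mem_filter, mem_univ, true_and] at hz ⊢
        rw [mul_pow, hz, inv_pow, hz₀, inv_one, one_mul]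
      · intro z _
        exact inv_mul_cancel_left₀ hz₀0 z
      · intro z _
        exact mul_inv_cancel_left₀ hz₀0 z
      · intro z _
        rw [map_mul]
    have h2 : (ψ z₀ - 1) * ∑ z ∈ μ, ψ z = 0 := by rw [sub_mul, one_mul, h1, sub_self]
    exact (mul_eq_zero.mp h2).resolve_left (sub_ne_zero.mpr hψz₀)
  set N : F → ℝ := fun ζ => ((univ.filter fun x => y x = ζ).card : ℝ) with hN
  have hdecomp : ∑ x, ψ (y x) = ∑ z ∈ μ, ψ z * (N z : ℂ) := by
    rw [← sum_filter_add_sum_filter_not univ (fun x => y x = 0)]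
    rw [sum_eq_zero (s := univ.filter fun x => y x = 0), zero_add]
    · rw [← sum_fiberwise_of_maps_to (s := univ.filter fun x => ¬ y x = 0) (t := μ) (g := y)]
      · refine sum_congr rfl fun z hz => ?_
        rw [filter_filter]
        have : (univ.filter fun x => ¬ y x = 0 ∧ y x = z) = univ.filter fun x => y x = z := by
          refine filter_congr fun x _ => ?_
          exact ⟨fun h => h.2, fun h => ⟨h ▸ hne z hz, h⟩⟩
        rw [this, sum_congr rfl (g := fun _ => ψ z) (fun x hx => by rw [(mem_filter.mp hx).2])]
        simp [hN, mul_comm]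
      · intro x hx
        rw [mem_filter] at hx
        simp only [hμ, mem_filter, mem_univ, true_and]
        exact (hy x).resolve_left hx.2
    · intro x hx
      rw [(mem_filter.mp hx).2]
      exact ψ.map_nonunit (by simp)
  have hcount : (Fintype.card α : ℝ) ≤ ∑ z ∈ μ, N z + n := by
    have h1 : Fintype.card α = (univ.filter fun x => y x = 0).card +
        ∑ z ∈ μ, (univ.filter fun x => y x = z).card := by
      rw [← card_univ, ← card_filter_add_card_filter_not (s := univ) (fun x => y x = 0)]
      congr 1
      rw [card_eq_sum_card_fiberwise (f := y) (t := μ)]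
      · refine sum_congr rfl fun z hz => ?_
        rw [filter_filter]
        congr 1
        refine filter_congr fun x _ => ?_
        exact ⟨fun h => h.2, fun h => ⟨h ▸ hne z hz, h⟩⟩
      · intro x hx
        rw [mem_coe, mem_filter] at hx
        simp only [hμ, coe_filter, mem_univ, true_and, Set.mem_ofPred_eq]
        exact (hy x).resolve_left hx.2
    rw [h1]
    push_cast
    simp only [hN]
    linarith
  have hcenter : ∑ x, ψ (y x) = ∑ z ∈ μ, ψ z * ((N z - B / d : ℝ) : ℂ) := by
    rw [hdecomp]
    push_cast
    simp only [mul_sub, sum_sub_distrib]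
    rw [← sum_mul, hsum0, zero_mul, sub_zero]
  rw [hcenter]
  calc ‖∑ z ∈ μ, ψ z * ((N z - B / d : ℝ) : ℂ)‖
      ≤ ∑ z ∈ μ, ‖ψ z * ((N z - B / d : ℝ) : ℂ)‖ := norm_sum_le _ _
    _ = ∑ z ∈ μ, (B / d - N z) := by
        refine sum_congr rfl fun z hz => ?_
        have hz1 : ‖ψ z‖ = 1 := by
          have := (mem_filter.mp hz).2
          have h2 : ψ z ^ d = 1 := by rw [← map_pow, this, map_one]
          exact Complex.norm_eq_one_of_pow_eq_one h2 hd.ne'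
        rw [norm_mul, hz1, one_mul, Complex.norm_real, Real.norm_of_nonpos, neg_sub]
        have := hB z (hne z hz)
        rw [sub_nonpos, le_div_iff₀ hd', mul_comm]
        exact this
    _ = μ.card * (B / d) - ∑ z ∈ μ, N z := by rw [sum_sub_distrib, sum_const, nsmul_eq_mul]
    _ ≤ d * (B / d) - ∑ z ∈ μ, N z := by gcongr
    _ ≤ B - Fintype.card α + n := by
        rw [mul_div_cancel₀ _ hd'.ne']
        linarith

open Polynomial in
/-- A mixed character sum over the even-degree extensions of `F` exhibits square-root cancellation,
with an implied constant independent of the extension. -/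
theorem exists_norm_sum_prod_mulChar_norm_le {F ι : Type*} [Field F] [Fintype F] [Fintype ι]
    {a : ι → F} (ha : Function.Injective a) {χ : ι → MulChar F ℂ} (hχ : χ ≠ 1) :
    ∃ C : ℝ, ∃ t₀ : ℕ, ∀ t ≥ t₀, ∀ (K : Type) [Field K] [Fintype K] [Algebra F K],
      Module.finrank F K = 2 * t →
      ‖∑ x : K, ∏ i, χ i (Algebra.norm F (algebraMap F K (a i) - x))‖ ≤
        C * (Fintype.card F : ℝ) ^ t := by
  classical
  obtain ⟨ψ, hψ⟩ := MulChar.exists_orderOf_eq_card_sub_one F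
  choose e he0 he using MulChar.exists_pow_eq_of_orderOf_eq_card hψ
  set q := Fintype.card F with hq
  have hq1 : 1 < q := Fintype.one_lt_card
  have hχq : χ ^ (q - 1) = 1 := by
    ext1 i
    rw [Pi.pow_apply, ← he (χ i), ← pow_mul, mul_comm, pow_mul, ← hψ, pow_orderOf_eq_one, one_pow,
      Pi.one_apply]
  set d := orderOf χ with hd
  have hdq : d ∣ q - 1 := orderOf_dvd_of_pow_eq_one hχq
  have hd0 : 0 < d := Nat.pos_of_dvd_of_pos hdq (by lia)
  have hd1 : 1 < d := by
    refine lt_of_le_of_ne hd0 fun h => hχ ?_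
    exact orderOf_eq_one_iff.mp h.symm
  obtain ⟨g, hg⟩ := hdq
  have hg0 : 0 < g := by
    rcases Nat.eq_zero_or_pos g with rfl | h
    · lia
    · exact h
  have hge : ∀ i, g ∣ e (χ i) := by
    intro i
    have h1 : ψ ^ (e (χ i) * d) = 1 := by
      rw [pow_mul, he, ← Pi.pow_apply, hd, pow_orderOf_eq_one, Pi.one_apply]
    have h2 : d * g ∣ d * e (χ i) := by
      rw [← hg, ← hψ, mul_comm]; exact orderOf_dvd_of_pow_eq_one h1
    exact Nat.dvd_of_mul_dvd_mul_left hd0 h2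
  choose e' he' using hge
  set D := ∑ i, e' i with hD
  have hψz : ∃ z : F, z ^ d = 1 ∧ ψ z ≠ 1 := by
    obtain ⟨γ, hγ⟩ := IsCyclic.exists_generator (α := Fˣ)
    refine ⟨((γ ^ g : Fˣ) : F), ?_, fun h => ?_⟩
    · rw [← Units.val_pow_eq_pow_val, ← pow_mul, mul_comm, ← hg, hq, ← Fintype.card_units,
        pow_card_eq_one, Units.val_one]
    · have h1 : ψ ^ g = 1 := by
        refine MulChar.ext fun u => ?_
        obtain ⟨n, rfl⟩ := mem_powers_iff_mem_zpowers.mpr (hγ u)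
        rw [MulChar.pow_apply_coe, MulChar.one_apply_coe, ← map_pow, ← Units.val_pow_eq_pow_val]
        change ψ (((γ ^ n) ^ g : Fˣ) : F) = 1
        rw [← pow_mul, mul_comm, pow_mul, Units.val_pow_eq_pow_val, map_pow, h, one_pow]
      have h2 := orderOf_dvd_of_pow_eq_one h1
      rw [hψ, hg] at h2
      have h3 := Nat.le_of_dvd hg0 h2
      nlinarith
  refine ⟨2 * d * D + 1 + Fintype.card ι, d * (d * D * (D + 1) + D + 1), ?_⟩
  intro t ht K _ _ _ hK
  set r := q ^ t with hr
  have hrt : t < r := Nat.lt_pow_self hq1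
  have hdr : d ∣ r - 1 := (Dvd.intro _ hg.symm).trans (by simpa using Nat.sub_dvd_pow_sub_pow q 1 t)
  obtain ⟨r', hr'⟩ := hdr
  have hr1 : r = d * r' + 1 := by lia
  have hr'big : d * D * (D + 1) + D < r' := by
    have h1 : d * (d * D * (D + 1) + D + 1) ≤ d * r' := by lia
    exact Nat.le_of_mul_le_mul_left h1 hd0
  have hcardK : Nat.card K = r * r := by
    rw [Module.natCard_eq_pow_finrank (K := F), hK, Nat.card_eq_fintype_card, ← hq, hr, two_mul,
      pow_add]
  have hfcardK : Fintype.card K = r * r := by rw [← hcardK, Nat.card_eq_fintype_card]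
  set M := (Nat.card K - 1) / (Nat.card F - 1) with hM
  have hMg : r' * (r + 1) = g * M := by
    have hM1 : d * g * M = d * r' * (r + 1) := by
      have h1 : q - 1 ∣ r * r - 1 := by
        rw [hr, ← pow_add]; simpa using Nat.sub_dvd_pow_sub_pow q 1 (t + t)
      rw [← hg, hM, hcardK, Nat.card_eq_fintype_card, ← hq, Nat.mul_div_cancel' h1, ← hr', mul_comm]
      rw [mul_comm (r - 1)]
      exact Nat.mul_self_sub_mul_self_eq r 1
    rw [mul_assoc, mul_assoc] at hM1
    exact (Nat.eq_of_mul_eq_mul_left hd0 hM1).symm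
  set Ω := AlgebraicClosure K
  have hnorm : ∀ z : K, algebraMap F K (Algebra.norm F z) = z ^ M := fun z =>
    FiniteField.algebraMap_norm_eq_pow
  set N : ι → K → F := fun i x => Algebra.norm F (algebraMap F K (a i) - x) with hN
  set y : K → F := fun x => ∏ i, N i x ^ e (χ i) with hy
  set f : Polynomial Ω := ∏ i, (C (algebraMap F Ω (a i)) - X) ^ e' i with hf
  have hlin : ∀ i, C (algebraMap F Ω (a i)) - X ≠ 0 := fun j => by
    rw [← neg_sub]; exact neg_ne_zero.mpr (X_sub_C_ne_zero _)
  have hf0 : f ≠ 0 := prod_ne_zero_iff.mpr fun i _ => pow_ne_zero _ (hlin i)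
  have hfdeg : f.natDegree = D := by
    rw [hf, natDegree_prod _ _ fun i _ => pow_ne_zero _ (hlin i), hD]
    refine sum_congr rfl fun i _ => ?_
    rw [natDegree_pow, ← neg_sub, natDegree_neg, natDegree_X_sub_C, mul_one]
  have hyf : ∀ x, algebraMap F Ω (y x) = f.eval (algebraMap K Ω x) ^ (r' * (r + 1)) := by
    intro x
    rw [IsScalarTower.algebraMap_apply F K Ω, hMg, hf, eval_prod, hy, map_prod, map_prod,
      ← prod_pow]
    refine prod_congr rfl fun i _ => ?_
    rw [map_pow, hN, hnorm, he', map_pow, map_pow, map_sub, eval_pow, eval_sub, eval_C, eval_X,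
      ← IsScalarTower.algebraMap_apply]
    ring
  have hψy : ∀ x, ψ (y x) = ∏ i, χ i (N i x) := by
    intro x
    rw [hy, map_prod]
    refine prod_congr rfl fun i _ => ?_
    rw [map_pow, ← MulChar.pow_apply' _ (he0 _).ne', he]
  have hyd : ∀ x, y x = 0 ∨ y x ^ d = 1 := by
    intro x
    refine or_iff_not_imp_left.mpr fun h => ?_
    rw [hy, ← prod_pow]
    refine prod_eq_one fun i _ => ?_
    have h1 : N i x ≠ 0 := by
      have := prod_ne_zero_iff.mp h i (mem_univ i)
      exact (pow_ne_zero_iff (he0 _).ne').mp this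
    rw [he', ← pow_mul, show g * e' i * d = (q - 1) * e' i by rw [hg]; ring, pow_mul, hq,
      FiniteField.pow_card_sub_one_eq_one _ h1, one_pow]
  have hzero : ((univ.filter fun x => y x = 0).card : ℝ) ≤ Fintype.card ι := by
    have : (univ.filter fun x => y x = 0) ⊆ univ.image fun i => algebraMap F K (a i) := by
      intro x hx
      obtain ⟨i, _, hi⟩ := prod_eq_zero_iff.mp (mem_filter.mp hx).2
      rw [pow_eq_zero_iff (he0 _).ne', hN, Algebra.norm_eq_zero_iff, sub_eq_zero] at hi
      exact mem_image.mpr ⟨i, mem_univ i, hi⟩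
    exact_mod_cast (card_le_card this).trans card_image_le
  obtain ⟨p, hp⟩ := CharP.exists F
  have : Fact p.Prime := ⟨CharP.char_is_prime F p⟩
  have : CharP Ω p := charP_of_injective_algebraMap (algebraMap F Ω).injective p
  obtain ⟨m, -, hm⟩ := FiniteField.card F p
  have hfib : ∀ ζ : F, ζ ≠ 0 → (d : ℝ) * ((univ.filter fun x => y x = ζ).card : ℝ) ≤
      r * r + (2 * d * D + 1) * r := by
    intro ζ hζ
    have h := card_mul_le_of_eval_pow_eq (k := Ω) (p := p) hd1 hf0 ?_ (r := r) (r' := r')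
      (s := m * t) (by rw [hr, hq, hm, pow_mul]) hr1 (by rw [hfdeg]; exact hr'big)
      (ζ := algebraMap F Ω ζ) (by simpa using hζ)
      ((univ.filter fun x => y x = ζ).image (algebraMap K Ω)) ?_
    · rw [card_image_of_injective _ (algebraMap K Ω).injective, hfdeg] at h
      exact_mod_cast h
    · intro t P Q c hc hQ h
      have h1 := dvd_mul_of_prod_linear_pow_mul_pow_eq
        ((algebraMap F Ω).injective.comp ha) e' hc hQ h
      refine orderOf_dvd_of_pow_eq_one (funext fun i => ?_)
      obtain ⟨w, hw⟩ := h1 i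
      rw [Pi.pow_apply, ← he (χ i), ← pow_mul, he', show g * e' i * t = (q - 1) * w by
        rw [hg, mul_assoc, mul_comm (e' i), hw]; ring, pow_mul, ← hψ, pow_orderOf_eq_one, one_pow,
        Pi.one_apply]
    · intro x hx
      obtain ⟨x, hx', rfl⟩ := mem_image.mp hx
      refine ⟨?_, ?_⟩
      · rw [← map_pow, ← hfcardK, FiniteField.pow_card]
      · rw [← hyf, (mem_filter.mp hx').2]
  have hmain := norm_sum_mulChar_le_of_card_fiber_le ψ hd0 hψz y hyd hfib hzero (by positivity)
  have hsum : ∑ x, ψ (y x) = ∑ x, ∏ i, χ i (N i x) := sum_congr rfl fun x _ => hψy x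
  rw [hsum, hfcardK] at hmain
  refine hmain.trans ?_
  have h1 : (1 : ℝ) ≤ r := by exact_mod_cast Nat.one_le_iff_ne_zero.mpr (by lia)
  have h2 : ((q : ℝ) ^ t) = r := by rw [hr]; push_cast; rfl
  rw [h2]
  push_cast
  nlinarith [(Nat.cast_nonneg (Fintype.card ι) : (0 : ℝ) ≤ _)]

section MonicsOfDegree

open Polynomial

theorem finite_setOf_isMonicOfDegree (F : Type*) [Field F] [Finite F] (k : ℕ) :
    {g : F[X] | IsMonicOfDegree g k}.Finite := by
  refine Set.Finite.of_finite_image (f := fun g (i : Fin (k + 1)) => g.coeff i) (Set.toFinite _) ?_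
  intro g hg h hh hgh
  ext i
  rcases lt_or_ge i (k + 1) with hi | hi
  · exact congr_fun hgh ⟨i, hi⟩
  · rw [coeff_eq_zero_of_natDegree_lt (hg.natDegree_eq.trans_lt hi),
      coeff_eq_zero_of_natDegree_lt (hh.natDegree_eq.trans_lt hi)]

/-- The monic polynomials of degree `k` over a finite field. -/
noncomputable def monicsOfDegree (F : Type*) [Field F] [Finite F] (k : ℕ) : Finset F[X] :=
  (finite_setOf_isMonicOfDegree F k).toFinset

@[simp]
theorem mem_monicsOfDegree {F : Type*} [Field F] [Finite F] {k : ℕ} {g : F[X]} :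
    g ∈ monicsOfDegree F k ↔ IsMonicOfDegree g k :=
  Set.Finite.mem_toFinset _

/-- The characteristic polynomial of `x` over `F`, as a power of the minimal polynomial. -/
noncomputable def minpolyPow (F : Type*) {K : Type*} [Field F] [Field K] [Algebra F K] (x : K) :
    F[X] :=
  minpoly F x ^ (Module.finrank F K / (minpoly F x).natDegree)

theorem isMonicOfDegree_minpolyPow {F K : Type*} [Field F] [Field K] [Algebra F K]
    [FiniteDimensional F K] (x : K) : IsMonicOfDegree (minpolyPow F x) (Module.finrank F K) := by
  have hx : IsIntegral F x := Algebra.IsIntegral.isIntegral x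
  refine ⟨?_, (minpoly.monic hx).pow _⟩
  rw [minpolyPow, natDegree_pow, Nat.div_mul_cancel (minpoly.degree_dvd hx)]

open IntermediateField in
theorem norm_algebraMap_sub {F K : Type*} [Field F] [Field K] [Algebra F K]
    [FiniteDimensional F K] (a : F) (x : K) :
    Algebra.norm F (algebraMap F K a - x) = (minpolyPow F x).eval a := by
  have hx : IsIntegral F x := Algebra.IsIntegral.isIntegral x
  set w := algebraMap F K a - x with hw
  have hwi : IsIntegral F w := Algebra.IsIntegral.isIntegral w
  have hmin : minpoly F w = (-1) ^ (minpoly F x).natDegree *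
      ((minpoly F x).comp (X + C a)).comp (-X) := by
    rw [hw, ← neg_sub, minpoly.neg, minpoly.sub_algebraMap, natDegree_comp, natDegree_X_add_C,
      mul_one]
  have hdeg : (minpoly F w).natDegree = (minpoly F x).natDegree := by
    rw [hmin]
    have : ((-1) ^ (minpoly F x).natDegree : F[X]) = C ((-1) ^ (minpoly F x).natDegree) := by simp
    rw [this, natDegree_C_mul (pow_ne_zero _ (neg_ne_zero.mpr one_ne_zero)), natDegree_comp,
      natDegree_comp, natDegree_X_add_C, natDegree_neg, natDegree_X, mul_one, mul_one]
  have hfin : Module.finrank F⟮w⟯ K = Module.finrank F K / (minpoly F x).natDegree := by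
    rw [← hdeg, ← adjoin.finrank hwi, ← Module.finrank_mul_finrank F F⟮w⟯ K,
      Nat.mul_div_cancel_left _ Module.finrank_pos]
  rw [Algebra.norm_eq_norm_adjoin F w, hfin, minpolyPow, eval_pow]
  congr 1
  rw [← adjoin.powerBasis_gen hwi, Algebra.PowerBasis.norm_gen_eq_coeff_zero_minpoly,
    adjoin.powerBasis_gen hwi, adjoin.powerBasis_dim, hdeg]
  have : minpoly F (AdjoinSimple.gen F w) = minpoly F w := by
    rw [← minpoly.algebraMap_eq (algebraMap F⟮w⟯ K).injective, AdjoinSimple.algebraMap_gen]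
  rw [this, hmin, coeff_zero_eq_eval_zero]
  simp [eval_comp, ← mul_assoc, ← mul_pow]

theorem card_filter_minpoly_eq {F K : Type*} [Field F] [Fintype F] [Field K] [Fintype K]
    [DecidableEq F[X]] [Algebra F K] {P : F[X]} (hP : Irreducible P) (hm : P.Monic)
    (hd : P.natDegree ∣ Module.finrank F K) :
    (univ.filter fun x : K => minpoly F x = P).card = P.natDegree := by
  classical
  have hsplit : (P.map (algebraMap F K)).Splits := by
    have h1 := (hP.natDegree_dvd_iff_dvd_X_pow_card_pow_sub_X).mp hd
    rw [← Module.natCard_eq_pow_finrank (K := F) (V := K)] at h1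
    refine Splits.of_dvd ?_ ?_ (map_dvd (algebraMap F K) h1)
    · have := FiniteField.isSplittingField_sub K F
      rw [← Nat.card_eq_fintype_card] at this
      exact IsSplittingField.splits K (X ^ Nat.card K - X : F[X])
    · exact (Polynomial.map_ne_zero_iff (algebraMap F K).injective).mpr
        (FiniteField.X_pow_card_sub_X_ne_zero F Finite.one_lt_card)
  rw [← card_rootSet_eq_natDegree (PerfectField.separable_of_irreducible hP) hsplit,
    Fintype.card_subtype]
  congr 1
  refine filter_congr fun x _ => ?_
  rw [mem_rootSet_of_ne hP.ne_zero]
  constructor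
  · rintro rfl
    exact minpoly.aeval F x
  · intro h
    exact (minpoly.eq_of_irreducible_of_monic hP h hm).symm

open UniqueFactorizationMonoid in
theorem natDegree_eq_sum_normalizedFactors {F : Type*} [Field F] [DecidableEq F] {g : F[X]}
    (hg : g.Monic) :
    g.natDegree = ∑ P ∈ (normalizedFactors g).toFinset,
      (normalizedFactors g).count P * P.natDegree := by
  have h1 : (normalizedFactors g).prod = g := by
    rw [prod_normalizedFactors_eq hg.ne_zero, hg.normalize_eq_self]
  have hmon : ∀ P ∈ normalizedFactors g, P.Monic := fun P hP => by
    rw [← normalize_normalized_factor P hP]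
    exact monic_normalize (irreducible_of_normalized_factor P hP).ne_zero
  conv_lhs => rw [← h1]
  rw [natDegree_multiset_prod_of_monic _ hmon, Finset.sum_multiset_map_count]
  simp

open UniqueFactorizationMonoid in
theorem sum_card_filter_minpolyPow_dvd {F : Type*} [Field F] [Fintype F] (K : ℕ → Type)
    [∀ j, Field (K j)] [∀ j, Fintype (K j)] [∀ j, Algebra F (K j)]
    (hK : ∀ j, Module.finrank F (K j) = j + 1) [DecidableRel ((· ∣ ·) : F[X] → F[X] → Prop)]
    {g : F[X]} {k : ℕ} (hg : IsMonicOfDegree g k) :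
    ∑ j ∈ range k, (univ.filter fun x : K j => minpolyPow F x ∣ g).card = k := by
  classical
  have hg0 : g ≠ 0 := hg.ne_zero
  set S := (normalizedFactors g).toFinset with hS
  have hSprop : ∀ P ∈ S, Irreducible P ∧ P.Monic := fun P hP => by
    rw [hS, Multiset.mem_toFinset] at hP
    refine ⟨irreducible_of_normalized_factor P hP, ?_⟩
    rw [← normalize_normalized_factor P hP]
    exact monic_normalize (irreducible_of_normalized_factor P hP).ne_zero
  have hdvd : ∀ P ∈ S, ∀ m, P ^ m ∣ g ↔ m ≤ (normalizedFactors g).count P := by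
    intro P hP m
    rw [pow_dvd_iff_le_emultiplicity, emultiplicity_eq_count_normalizedFactors (hSprop P hP).1 hg0,
      (hSprop P hP).2.normalize_eq_self, Nat.cast_le]
  have hcard : ∀ j, (univ.filter fun x : K j => minpolyPow F x ∣ g).card =
      ∑ P ∈ S, if P.natDegree ∣ j + 1 ∧ (j + 1) / P.natDegree ≤ (normalizedFactors g).count P
        then P.natDegree else 0 := by
    intro j
    rw [card_eq_sum_card_fiberwise (f := fun x : K j => minpoly F x) (t := S)]
    · refine sum_congr rfl fun P hP => ?_
      rw [filter_filter]
      split_ifs with h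
      · rw [← card_filter_minpoly_eq (K := K j) (hSprop P hP).1 (hSprop P hP).2
          (by rw [hK]; exact h.1)]
        congr 1
        refine filter_congr fun x _ => ⟨fun h => h.2, fun hx => ⟨?_, hx⟩⟩
        rw [minpolyPow, hx, hK]
        exact (hdvd P hP _).mpr h.2
      · rw [card_eq_zero, filter_eq_empty_iff]
        rintro x - ⟨hx, hxP⟩
        rw [minpolyPow, hK, hxP] at hx
        refine h ⟨?_, (hdvd P hP _).mp hx⟩
        rw [← hK j, ← hxP]
        exact minpoly.degree_dvd (Algebra.IsIntegral.isIntegral x)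
    · intro x hx
      rw [mem_coe, mem_filter] at hx
      have hxi : IsIntegral F x := Algebra.IsIntegral.isIntegral x
      rw [mem_coe, hS, Multiset.mem_toFinset, mem_normalizedFactors_iff' hg0]
      refine ⟨minpoly.irreducible hxi, (minpoly.monic hxi).normalize_eq_self, ?_⟩
      refine (dvd_pow_self _ ?_).trans hx.2
      have h1 := minpoly.degree_dvd hxi
      have h2 := Nat.le_of_dvd (by rw [hK]; lia) h1
      exact (Nat.div_pos h2 (minpoly.natDegree_pos hxi)).ne'
  rw [sum_congr rfl fun j _ => hcard j, sum_comm]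
  conv_rhs => rw [← hg.natDegree_eq, natDegree_eq_sum_normalizedFactors hg.monic]
  refine sum_congr rfl fun P hP => ?_
  rw [← sum_filter, sum_const, smul_eq_mul]
  congr 1
  have hP0 : 0 < P.natDegree := (hSprop P hP).1.natDegree_pos
  have hvk : (normalizedFactors g).count P * P.natDegree ≤ k := by
    rw [← hg.natDegree_eq, natDegree_eq_sum_normalizedFactors hg.monic]
    exact single_le_sum (f := fun P => (normalizedFactors g).count P * P.natDegree)
      (fun _ _ => Nat.zero_le _) hP
  refine ((card_range ((normalizedFactors g).count P)).symm.trans ?_).symm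
  refine card_bij (fun m _ => (m + 1) * P.natDegree - 1) ?_ ?_ ?_
  · intro m hm
    rw [mem_range] at hm
    have h1 : (m + 1) * P.natDegree ≤ (normalizedFactors g).count P * P.natDegree :=
      Nat.mul_le_mul_right _ hm
    have h2 : (m + 1) * P.natDegree - 1 + 1 = (m + 1) * P.natDegree :=
      Nat.sub_add_cancel (Nat.mul_pos m.succ_pos hP0)
    rw [mem_filter, mem_range, h2]
    exact ⟨by lia, dvd_mul_left _ _, by rw [Nat.mul_div_cancel _ hP0]; exact hm⟩
  · intro m _ m' _ h
    have h1 : (m + 1) * P.natDegree = (m' + 1) * P.natDegree := by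
      have := Nat.mul_pos m.succ_pos hP0
      have := Nat.mul_pos m'.succ_pos hP0
      lia
    have := Nat.eq_of_mul_eq_mul_right hP0 h1
    lia
  · intro j hj
    rw [mem_filter, mem_range] at hj
    obtain ⟨-, ⟨m, hm⟩, hle⟩ := hj
    rw [hm, Nat.mul_div_cancel_left _ hP0] at hle
    have hm0 : 0 < m := by
      rcases Nat.eq_zero_or_pos m with rfl | h
      · lia
      · exact h
    refine ⟨m - 1, mem_range.mpr (by lia), ?_⟩
    rw [Nat.sub_add_cancel hm0, mul_comm, ← hm]
    rfl

theorem mul_sum_monicsOfDegree_eq {F : Type*} [Field F] [Fintype F] (K : ℕ → Type)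
    [∀ j, Field (K j)] [∀ j, Fintype (K j)] [∀ j, Algebra F (K j)]
    (hK : ∀ j, Module.finrank F (K j) = j + 1) (f : F[X] →* ℂ) (k : ℕ) :
    (k : ℂ) * ∑ g ∈ monicsOfDegree F k, f g =
      ∑ j ∈ range k, (∑ x : K j, f (minpolyPow F x)) *
        ∑ g ∈ monicsOfDegree F (k - 1 - j), f g := by
  classical
  have h1 : (k : ℂ) * ∑ g ∈ monicsOfDegree F k, f g =
      ∑ j ∈ range k, ∑ x : K j, ∑ g ∈ (monicsOfDegree F k).filter (minpolyPow F x ∣ ·), f g := by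
    rw [mul_sum]
    simp only [sum_filter]
    rw [sum_congr rfl fun j _ => sum_comm, sum_comm]
    refine sum_congr rfl fun g hg => ?_
    have h2 := sum_card_filter_minpolyPow_dvd K hK (mem_monicsOfDegree.mp hg)
    conv_lhs => rw [← h2]
    push_cast
    rw [sum_mul]
    refine sum_congr rfl fun j _ => ?_
    rw [← sum_filter, sum_const, nsmul_eq_mul]
  rw [h1]
  refine sum_congr rfl fun j hj => ?_
  rw [mem_range] at hj
  rw [sum_mul]
  refine sum_congr rfl fun x _ => ?_
  have hh : IsMonicOfDegree (minpolyPow F x) (j + 1) := hK j ▸ isMonicOfDegree_minpolyPow x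
  rw [mul_sum]
  symm
  refine sum_bij (fun g _ => minpolyPow F x * g) ?_ ?_ ?_ ?_
  · intro g hg
    rw [mem_monicsOfDegree] at hg
    rw [mem_filter, mem_monicsOfDegree]
    refine ⟨?_, dvd_mul_right _ _⟩
    have := hh.mul hg
    rwa [show j + 1 + (k - 1 - j) = k by lia] at this
  · intro g _ g' _ h
    exact mul_left_cancel₀ hh.ne_zero h
  · intro g hg
    rw [mem_filter, mem_monicsOfDegree] at hg
    obtain ⟨hg, g', rfl⟩ := hg
    refine ⟨g', ?_, rfl⟩
    rw [mem_monicsOfDegree]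
    refine hh.of_mul_left ?_
    rwa [show j + 1 + (k - 1 - j) = k by lia]
  · intro g _
    rw [map_mul]

end MonicsOfDegree

open Polynomial in
theorem sum_monicsOfDegree_prod_mulChar_eval_eq_zero {F ι : Type*} [Field F] [Fintype F]
    [Fintype ι] {a : ι → F} (ha : Function.Injective a) {χ : ι → MulChar F ℂ} (hχ : χ ≠ 1) {k : ℕ}
    (hk : Fintype.card ι ≤ k) :
    ∑ g ∈ monicsOfDegree F k, ∏ i, χ i (g.eval (a i)) = 0 := by
  classical
  obtain ⟨i, hi⟩ := Function.ne_iff.mp hχ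
  obtain ⟨b, hb⟩ := MulChar.ne_one_iff.mp hi
  set ℓ : F[X] := Lagrange.basis univ a i with hℓ
  have hinj : Set.InjOn a (univ : Finset ι) := ha.injOn
  have hℓi : ℓ.eval (a i) = 1 := Lagrange.eval_basis_self hinj (mem_univ i)
  have hℓj : ∀ j, j ≠ i → ℓ.eval (a j) = 0 := fun j hj =>
    Lagrange.eval_basis_of_ne hj.symm (mem_univ j)
  have hℓdeg : ℓ.natDegree < k := by
    rw [hℓ, Lagrange.natDegree_basis hinj (mem_univ i), card_univ]
    have := Fintype.card_pos_iff.mpr ⟨i⟩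
    lia
  set T : F → F[X] → F[X] := fun c g => g + C ((c - 1) * g.eval (a i)) * ℓ with hT
  have hTi : ∀ c g, (T c g).eval (a i) = c * g.eval (a i) := by
    intro c g
    simp only [hT, eval_add, eval_mul, eval_C, hℓi]
    ring
  have hTj : ∀ c g j, j ≠ i → (T c g).eval (a j) = g.eval (a j) := by
    intro c g j hj
    simp only [hT, eval_add, eval_mul, eval_C, hℓj j hj]
    ring
  have hTm : ∀ c, ∀ g ∈ monicsOfDegree F k, T c g ∈ monicsOfDegree F k := by
    intro c g hg
    rw [mem_monicsOfDegree] at hg ⊢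
    exact hg.add_right ((natDegree_C_mul_le _ _).trans_lt hℓdeg)
  have hTT : ∀ c c', c' * c = 1 → ∀ g, T c' (T c g) = g := by
    intro c c' h g
    have h1 : T c' (T c g) = T c g + C ((c' - 1) * (T c g).eval (a i)) * ℓ := rfl
    have h2 : (c - 1) * g.eval (a i) + (c' - 1) * (c * g.eval (a i)) = 0 := by
      linear_combination (g.eval (a i)) * h
    rw [h1, hTi]
    change g + _ + _ = g
    rw [add_assoc, ← add_mul, ← C_add, h2, C_0, zero_mul, add_zero]
  have hTX : ∀ g : F[X], ∏ j, χ j ((T b g).eval (a j)) = χ i b * ∏ j, χ j (g.eval (a j)) := by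
    intro g
    rw [← mul_prod_erase univ _ (mem_univ i), ← mul_prod_erase univ (fun j => χ j (g.eval (a j)))
      (mem_univ i), hTi, map_mul, mul_assoc]
    congr 2
    exact prod_congr rfl fun j hj => by rw [hTj _ _ _ (ne_of_mem_erase hj)]
  have hsum : ∑ g ∈ monicsOfDegree F k, ∏ j, χ j (g.eval (a j)) =
      χ i b * ∑ g ∈ monicsOfDegree F k, ∏ j, χ j (g.eval (a j)) := by
    rw [mul_sum]
    symm
    refine sum_bij' (fun g _ => T b g) (fun g _ => T ((b⁻¹ : Fˣ) : F) g) (hTm _) (hTm _) ?_ ?_ ?_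
    · exact fun g _ => hTT _ _ (Units.inv_mul b) g
    · exact fun g _ => hTT _ _ (Units.mul_inv b) g
    · exact fun g _ => (hTX g).symm
  have h3 : (1 - χ i b) * ∑ g ∈ monicsOfDegree F k, ∏ j, χ j (g.eval (a j)) = 0 := by
    rw [sub_mul, one_mul, ← hsum, sub_self]
  exact (mul_eq_zero.mp h3).resolve_left (sub_ne_zero.mpr hb.symm)

open Polynomial in
/-- A sequence related by Newton's identities to the coefficients of a polynomial
consists of power sums, up to sign. -/
theorem exists_eq_neg_sum_pow_of_newton {c S : ℕ → ℂ} {N : ℕ} (h0 : c 0 = 1)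
    (hc : ∀ k, N < k → c k = 0)
    (hS : ∀ k : ℕ, (k : ℂ) * c k = ∑ j ∈ range k, S j * c (k - 1 - j)) :
    ∃ ω : Fin N → ℂ, ∀ j, S j = -∑ i, ω i ^ (j + 1) := by
  set P : ℂ[X] := ∑ k ∈ range (N + 1), C (c k) * X ^ (N - k) with hP
  have hcoeff : ∀ k ≤ N, P.coeff (N - k) = c k := by
    intro k hk
    rw [hP, finsetSum_coeff, sum_eq_single k]
    · simp
    · intro l hl hlk
      rw [mem_range] at hl
      rw [coeff_C_mul, coeff_X_pow, if_neg (by lia), mul_zero]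
    · intro h
      exact absurd (mem_range.mpr (by lia)) h
  have hle : P.natDegree ≤ N := natDegree_sum_le_of_forall_le _ _ fun k _ =>
    (natDegree_C_mul_X_pow_le _ _).trans (Nat.sub_le _ _)
  have hmonic : P.Monic := monic_of_natDegree_le_of_coeff_eq_one N hle (by
    rw [← h0, ← hcoeff 0 N.zero_le, Nat.sub_zero])
  have hdeg : P.natDegree = N := by
    refine le_antisymm hle (le_natDegree_of_ne_zero ?_)
    have := hcoeff 0 N.zero_le
    rw [Nat.sub_zero, h0] at this
    rw [this]
    exact one_ne_zero
  have hsplit : P.Splits := IsAlgClosed.splits P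
  have hcard : P.roots.card = N := by rw [← hsplit.natDegree_eq_card_roots, hdeg]
  have hfin : ∀ (s : Multiset ℂ) (M : ℕ), s.card = M → ∃ ω : Fin M → ℂ, univ.val.map ω = s := by
    rintro s _ rfl
    refine ⟨fun i => s.toList.get (i.cast (by simp)), ?_⟩
    rw [Fin.univ_val_map]
    conv_rhs => rw [← Multiset.coe_toList s]
    congr 1
    refine List.ext_get (by simp) fun n h1 h2 => ?_
    simp
  obtain ⟨ω, hω⟩ := hfin P.roots N hcard
  set e : ℕ → ℂ := fun k => (univ.val.map ω).esymm k with he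
  have hec : ∀ k, (-1) ^ k * e k = c k := by
    intro k
    rcases le_or_gt k N with hk | hk
    · have h1 : P = (P.roots.map fun t => X - C t).prod := hsplit.eq_prod_roots_of_monic hmonic
      rw [← hcoeff k hk, he, hω, h1, Multiset.prod_X_sub_C_coeff _ (by rw [hcard]; lia), hcard,
        ← h1, Nat.sub_sub_self hk]
    · have h1 : Multiset.powersetCard k (univ.val.map ω) = 0 :=
        Multiset.powersetCard_eq_empty _ (by simpa using hk)
      simp only [hc k hk, he, Multiset.esymm, h1, Multiset.map_zero, Multiset.sum_zero, mul_zero]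
  set p : ℕ → ℂ := fun j => ∑ i, ω i ^ j with hp
  have hnewton : ∀ k : ℕ, (k : ℂ) * c k = ∑ j ∈ range k, (-p (j + 1)) * c (k - 1 - j) := by
    intro k
    have h1 := congr_arg (MvPolynomial.aeval ω) (MvPolynomial.mul_esymm_eq_sum (Fin N) ℂ k)
    simp only [map_mul, map_natCast, map_pow, map_neg, map_one, map_sum,
      MvPolynomial.aeval_esymm_eq_multiset_esymm, MvPolynomial.psum, MvPolynomial.aeval_X] at h1
    have h2 : (k : ℂ) * c k = -∑ a ∈ antidiagonal k with a.1 < k, c a.1 * p a.2 := by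
      rw [← hec, mul_left_comm]
      change (-1) ^ k * (k * (univ.val.map ω).esymm k) = _
      rw [h1, ← mul_assoc, ← pow_add, show k + (k + 1) = 2 * k + 1 by ring, pow_succ, pow_mul]
      simp only [neg_one_sq, one_pow, one_mul, neg_mul]
      congr 1
      exact sum_congr rfl fun a _ => by rw [← hec]
    rw [h2, ← sum_neg_distrib]
    symm
    refine sum_bij (fun j _ => (k - 1 - j, j + 1)) ?_ ?_ ?_ ?_
    · intro j hj
      rw [mem_range] at hj
      rw [mem_filter, HasAntidiagonal.mem_antidiagonal]
      constructor <;> simp only <;> lia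
    · intro j _ j' _ h
      simpa using congr_arg Prod.snd h
    · rintro ⟨u, v⟩ h
      rw [mem_filter, HasAntidiagonal.mem_antidiagonal] at h
      simp only at h
      refine ⟨v - 1, mem_range.mpr (by lia), ?_⟩
      ext <;> simp only <;> lia
    · intro j _
      ring
  refine ⟨ω, fun j => ?_⟩
  induction j using Nat.strong_induction_on with
  | _ j ih =>
    have h1 := (hS (j + 1)).symm.trans (hnewton (j + 1))
    rw [sum_range_succ, sum_range_succ, sum_congr rfl fun l hl => by rw [ih l (mem_range.mp hl)]]
      at h1
    have h2 := add_left_cancel h1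
    simpa [h0] using h2

open Polynomial in
theorem norm_le_one_of_norm_sum_pow_le {ι : Type*} [Fintype ι] {β : ι → ℂ} {C₀ : ℝ} {t₀ : ℕ}
    (h : ∀ t ≥ t₀, ‖∑ i, β i ^ t‖ ≤ C₀) (i : ι) : ‖β i‖ ≤ 1 := by
  classical
  set R : ℂ[X] := ∏ z ∈ (univ.image β).erase (β i), (X - C z) with hR
  have hRi : R.eval (β i) ≠ 0 := by
    rw [hR, eval_prod]
    refine prod_ne_zero_iff.mpr fun z hz => ?_
    rw [eval_sub, eval_X, eval_C]
    exact sub_ne_zero.mpr (ne_of_mem_erase hz).symm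
  have hRj : ∀ j, β j ≠ β i → R.eval (β j) = 0 := by
    intro j hj
    rw [hR, eval_prod]
    refine prod_eq_zero (mem_erase.mpr ⟨hj, mem_image_of_mem β (mem_univ j)⟩) ?_
    simp
  set m := (univ.filter fun j => β j = β i).card with hm
  have hm0 : m ≠ 0 := card_ne_zero_of_mem (mem_filter.mpr ⟨mem_univ i, rfl⟩)
  have hid : ∀ t, (m : ℂ) * (β i ^ t * R.eval (β i)) =
      ∑ n ∈ range (R.natDegree + 1), R.coeff n * ∑ j, β j ^ (t + n) := by
    intro t
    have h1 : ∑ j, β j ^ t * R.eval (β j) = m * (β i ^ t * R.eval (β i)) := by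
      rw [← sum_filter_add_sum_filter_not univ (fun j => β j = β i),
        sum_eq_zero (s := univ.filter fun j => ¬ β j = β i), add_zero,
        sum_congr rfl (g := fun _ => β i ^ t * R.eval (β i)), sum_const, nsmul_eq_mul]
      · intro j hj
        rw [(mem_filter.mp hj).2]
      · intro j hj
        rw [hRj j (mem_filter.mp hj).2, mul_zero]
    rw [← h1]
    simp only [mul_sum, eval_eq_sum_range]
    rw [sum_comm]
    refine sum_congr rfl fun n _ => sum_congr rfl fun j _ => ?_
    rw [pow_add]
    ring
  set B := C₀ * ∑ n ∈ range (R.natDegree + 1), ‖R.coeff n‖ with hB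
  have hbound : ∀ t ≥ t₀, m * ‖R.eval (β i)‖ * ‖β i‖ ^ t ≤ B := by
    intro t ht
    have h1 : ‖(m : ℂ) * (β i ^ t * R.eval (β i))‖ = m * ‖R.eval (β i)‖ * ‖β i‖ ^ t := by
      rw [norm_mul, norm_mul, norm_pow, Complex.norm_natCast]
      ring
    rw [← h1, hid, hB, mul_sum]
    refine (norm_sum_le _ _).trans (sum_le_sum fun n _ => ?_)
    rw [norm_mul, mul_comm]
    exact mul_le_mul_of_nonneg_right (h _ (by lia)) (norm_nonneg _)
  by_contra! hlt
  have hpos : 0 < m * ‖R.eval (β i)‖ := by positivity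
  obtain ⟨n, hn⟩ := pow_unbounded_of_one_lt (B / (m * ‖R.eval (β i)‖)) hlt
  rw [div_lt_iff₀ hpos, mul_comm] at hn
  have h1 := hbound (n + t₀) (Nat.le_add_left _ _)
  have h2 : ‖β i‖ ^ n ≤ ‖β i‖ ^ (n + t₀) := pow_le_pow_right₀ hlt.le (Nat.le_add_right _ _)
  have h3 := mul_le_mul_of_nonneg_left h2 hpos.le
  linarith

open Polynomial in
/-- **Weil's bound** for products of multiplicative characters at distinct shifts. -/
theorem norm_sum_prod_mulChar_add_le {F ι : Type*} [Field F] [Fintype F] [Fintype ι]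
    {a : ι → F} (ha : Function.Injective a) {χ : ι → MulChar F ℂ} (hχ : χ ≠ 1) :
    ‖∑ x, ∏ i, χ i (a i + x)‖ ≤ (Fintype.card ι - 1 : ℕ) * √(Fintype.card F) := by
  classical
  obtain ⟨p, hp⟩ := CharP.exists F
  have : Fact p.Prime := ⟨CharP.char_is_prime F p⟩
  set K : ℕ → Type := fun j => FiniteField.Extension F p (j + 1) with hKdef
  let _ : ∀ j, Fintype (K j) := fun j => Fintype.ofFinite _
  have hK : ∀ j, Module.finrank F (K j) = j + 1 := fun j =>
    FiniteField.finrank_extension F p (j + 1)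
  let f : F[X] →* ℂ :=
    { toFun := fun g => ∏ i, χ i (g.eval (a i))
      map_one' := by simp
      map_mul' := fun g h => by simp [prod_mul_distrib] }
  have hf : ∀ g, f g = ∏ i, χ i (g.eval (a i)) := fun _ => rfl
  set c : ℕ → ℂ := fun k => ∑ g ∈ monicsOfDegree F k, f g with hc
  set S : ℕ → ℂ := fun j => ∑ x : K j, f (minpolyPow F x) with hS
  have hι : 0 < Fintype.card ι := by
    obtain ⟨i, -⟩ := Function.ne_iff.mp hχ
    exact Fintype.card_pos_iff.mpr ⟨i⟩
  have hc0 : c 0 = 1 := by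
    have : monicsOfDegree F 0 = {1} := by
      ext g
      rw [mem_monicsOfDegree, isMonicOfDegree_zero_iff, mem_singleton]
    rw [hc]
    simp only [this, sum_singleton, map_one]
  obtain ⟨ω, hω⟩ := exists_eq_neg_sum_pow_of_newton (c := c) (S := S) (N := Fintype.card ι - 1) hc0
    (fun k hk => sum_monicsOfDegree_prod_mulChar_eval_eq_zero ha hχ (by lia))
    (mul_sum_monicsOfDegree_eq K hK f)
  set q : ℝ := (Fintype.card F : ℝ) with hq
  have hq0 : 0 < q := by rw [hq]; exact_mod_cast Fintype.card_pos
  obtain ⟨C₀, t₀, hC⟩ := exists_norm_sum_prod_mulChar_norm_le ha hχ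
  have hωle : ∀ i, ‖ω i‖ ≤ √q := by
    intro i
    have h1 := norm_le_one_of_norm_sum_pow_le (β := fun i => ω i ^ 2 / (q : ℂ)) (C₀ := C₀)
      (t₀ := t₀ + 1) ?_ i
    · rw [norm_div, norm_pow, Complex.norm_real, Real.norm_of_nonneg hq0.le, div_le_one hq0] at h1
      exact Real.le_sqrt_of_sq_le h1
    · intro t ht
      have h2 : ∑ i, (ω i ^ 2 / (q : ℂ)) ^ t = -S (2 * t - 1) / (q : ℂ) ^ t := by
        rw [hω, neg_neg, sum_div, show 2 * t - 1 + 1 = 2 * t by lia]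
        exact sum_congr rfl fun i _ => by rw [div_pow, pow_mul]
      rw [h2, norm_div, norm_neg, norm_pow, Complex.norm_real, Real.norm_of_nonneg hq0.le,
        div_le_iff₀ (pow_pos hq0 t)]
      have h3 := hC t (by lia) (K (2 * t - 1)) (by rw [hK]; lia)
      simp only [norm_algebraMap_sub] at h3
      exact h3
  have hsum : ∑ x, ∏ i, χ i (a i + x) = c 1 := by
    rw [hc]
    refine sum_bij (fun x _ => X + C x) ?_ ?_ ?_ ?_
    · intro x _
      rw [mem_monicsOfDegree]
      exact isMonicOfDegree_X_add_one x
    · intro x _ y _ h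
      exact C_injective (add_left_cancel h)
    · intro g hg
      rw [mem_monicsOfDegree, isMonicOfDegree_one_iff] at hg
      obtain ⟨r, rfl⟩ := hg
      exact ⟨r, mem_univ r, rfl⟩
    · intro x _
      rw [hf]
      simp
  have hc1 : c 1 = S 0 := by
    have := mul_sum_monicsOfDegree_eq K hK f 1
    change ((1 : ℕ) : ℂ) * c 1 = ∑ j ∈ range 1, S j * c (1 - 1 - j) at this
    simpa [hc0] using this
  rw [hsum, hc1, hω, norm_neg]
  refine (norm_sum_le _ _).trans ?_
  refine (sum_le_card_nsmul _ _ (√q) fun i _ => by simpa using hωle i).trans ?_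
  rw [card_univ, Fintype.card_fin, nsmul_eq_mul]

/-- `φ` is a linear combination of characters whose orders divide `N`, where the trivial character
has coefficient `A` and the sum of the absolute values of the coefficients is at most `B`. -/
def MulCharExpansion {F : Type*} [Field F] (φ : F → ℂ) (N : ℕ) (A : ℂ) (B : ℝ) : Prop :=
  ∃ (I : Type) (_ : Fintype I) (c : I → ℂ) (χ : I → MulChar F ℂ),
    (∀ x, φ x = ∑ i, c i * χ i x) ∧ (∀ i, χ i ^ N = 1) ∧
      (∑ᶠ i ∈ {i | χ i = 1}, c i) = A ∧ ∑ i, ‖c i‖ ≤ B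

namespace MulCharExpansion

variable {F : Type*} [Field F]

open Classical in
theorem iff_sum_filter {φ : F → ℂ} {N : ℕ} {A : ℂ} {B : ℝ} : MulCharExpansion φ N A B ↔
    ∃ (I : Type) (_ : Fintype I) (c : I → ℂ) (χ : I → MulChar F ℂ),
      (∀ x, φ x = ∑ i, c i * χ i x) ∧ (∀ i, χ i ^ N = 1) ∧
        (∑ i with χ i = 1, c i) = A ∧ ∑ i, ‖c i‖ ≤ B := by
  unfold MulCharExpansion
  simp only [finsum_mem_eq_finite_toFinset_sum _ (Set.toFinite _), Set.Finite.toFinset_ofPred]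

theorem mul {φ φ' : F → ℂ} {N N' : ℕ} {A A' : ℂ} {B B' : ℝ} (h : MulCharExpansion φ N A B)
    (h' : MulCharExpansion φ' N' A' B') (hN : N.Coprime N') :
    MulCharExpansion (fun x => φ x * φ' x) (N * N') (A * A') (B * B') := by
  classical
  rw [iff_sum_filter] at h h' ⊢
  obtain ⟨I, _, c, χ, hφ, hχ, hA, hB⟩ := h
  obtain ⟨I', _, c', χ', hφ', hχ', hA', hB'⟩ := h'
  refine ⟨I × I', inferInstance, fun i => c i.1 * c' i.2, fun i => χ i.1 * χ' i.2, ?_, ?_, ?_, ?_⟩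
  · intro x
    rw [hφ, hφ', sum_mul_sum, Fintype.sum_prod_type]
    refine sum_congr rfl fun i _ => sum_congr rfl fun j _ => ?_
    rw [MulChar.mul_apply]
    ring
  · intro i
    rw [mul_pow, pow_mul, hχ, one_pow, mul_comm N, pow_mul, hχ', one_pow, one_mul]
  · rw [← hA, ← hA', sum_mul_sum, ← sum_product']
    refine sum_congr ?_ fun _ _ => rfl
    ext ⟨i, j⟩
    simp only [mem_filter, mem_univ, true_and, mem_product]
    constructor
    · intro hij
      have h1 : χ i = (χ' j)⁻¹ := eq_inv_of_mul_eq_one_left hij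
      have h2 : χ i ^ N' = 1 := by rw [h1, inv_pow, hχ', inv_one]
      have h3 : χ i = 1 := by
        rw [← orderOf_eq_one_iff]
        exact Nat.eq_one_of_dvd_coprimes hN (orderOf_dvd_of_pow_eq_one (hχ i))
          (orderOf_dvd_of_pow_eq_one h2)
      exact ⟨h3, by rwa [h3, one_mul] at hij⟩
    · rintro ⟨h1, h2⟩
      rw [h1, h2, one_mul]
  · rw [Fintype.sum_prod_type]
    simp only [norm_mul]
    rw [← sum_mul_sum]
    exact mul_le_mul hB hB' (sum_nonneg fun _ _ => norm_nonneg _)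
      ((sum_nonneg fun _ _ => norm_nonneg _).trans hB)

theorem add {φ φ' : F → ℂ} {N : ℕ} {A A' : ℂ} {B B' : ℝ} (h : MulCharExpansion φ N A B)
    (h' : MulCharExpansion φ' N A' B') :
    MulCharExpansion (fun x => φ x + φ' x) N (A + A') (B + B') := by
  classical
  rw [iff_sum_filter] at h h' ⊢
  obtain ⟨I, _, c, χ, hφ, hχ, hA, hB⟩ := h
  obtain ⟨I', _, c', χ', hφ', hχ', hA', hB'⟩ := h'
  refine ⟨I ⊕ I', inferInstance, Sum.elim c c', Sum.elim χ χ', ?_, ?_, ?_, ?_⟩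
  · intro x
    simp [hφ, hφ']
  · rintro (i | i)
    · exact hχ i
    · exact hχ' i
  · rw [← hA, ← hA']
    simp only [sum_filter, Fintype.sum_sum_type, Sum.elim_inl, Sum.elim_inr]
    congr!
  · simpa using add_le_add hB hB'

theorem norm_sum_prod_sub_le [Fintype F] [DecidableEq F] {ι : Type*} [Fintype ι] {a : ι → F}
    (ha : Function.Injective a) {φ : ι → F → ℂ} {N : ι → ℕ} {A : ι → ℂ} {B : ι → ℝ}
    (h : ∀ i, MulCharExpansion (φ i) (N i) (A i) (B i)) :
    ‖∑ x, ∏ i, φ i (a i + x) - (∏ i, A i) * (Fintype.card F - Fintype.card ι : ℂ)‖ ≤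
      (Fintype.card ι - 1 : ℕ) * √(Fintype.card F) * ∏ i, B i := by
  classical
  simp only [iff_sum_filter] at h
  choose I _ c χ hφ hχ hA hB using h
  have hexp : ∑ x, ∏ i, φ i (a i + x) =
      ∑ t : ∀ i, I i, (∏ i, c i (t i)) * ∑ x, ∏ i, χ i (t i) (a i + x) := by
    simp only [hφ, mul_sum]
    rw [sum_comm]
    refine sum_congr rfl fun x _ => ?_
    rw [prod_univ_sum, Fintype.piFinset_univ]
    exact sum_congr rfl fun t _ => prod_mul_distrib
  have htriv : ∑ x : F, ∏ i, (1 : MulChar F ℂ) (a i + x) =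
      (Fintype.card F - Fintype.card ι : ℂ) := by
    have h1 : ∀ x, ∏ i, (1 : MulChar F ℂ) (a i + x) =
        if x ∈ univ.image (fun i => -a i) then 0 else 1 := by
      intro x
      split_ifs with hx
      · obtain ⟨i, -, rfl⟩ := mem_image.mp hx
        refine prod_eq_zero (mem_univ i) ?_
        rw [add_neg_cancel]
        exact MulChar.map_nonunit _ not_isUnit_zero
      · refine prod_eq_one fun i _ => MulChar.one_apply ?_
        refine isUnit_iff_ne_zero.mpr fun h => hx ?_
        exact mem_image.mpr ⟨i, mem_univ i, neg_eq_of_add_eq_zero_right h⟩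
    simp only [h1]
    rw [sum_ite, sum_const_zero, zero_add, sum_const, nsmul_one, filter_not, filter_mem_eq_inter,
      univ_inter, ← compl_eq_univ_sdiff, card_compl,
      card_image_of_injective univ (f := fun i => -a i) (fun i j h => ha (neg_injective h)),
      card_univ,
      Nat.cast_sub (Fintype.card_le_of_injective a ha)]
  have hmain : (∏ i, A i) * (Fintype.card F - Fintype.card ι : ℂ) =
      ∑ t : ∀ i, I i with ∀ i, χ i (t i) = 1,
        (∏ i, c i (t i)) * ∑ x, ∏ i, χ i (t i) (a i + x) := by
    have h1 : ∏ i, A i = ∑ t : ∀ i, I i with ∀ i, χ i (t i) = 1, ∏ i, c i (t i) := by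
      simp only [← hA]
      rw [prod_univ_sum]
      refine sum_congr ?_ fun _ _ => rfl
      ext t
      simp [Fintype.mem_piFinset]
    rw [h1, sum_mul]
    refine sum_congr rfl fun t ht => ?_
    rw [mem_filter] at ht
    simp only [ht.2, htriv]
  rw [hexp, hmain, ← sum_filter_add_sum_filter_not univ (fun t : ∀ i, I i => ∀ i, χ i (t i) = 1),
    add_sub_cancel_left]
  set D : ℝ := (Fintype.card ι - 1 : ℕ) * √(Fintype.card F) with hD
  have hD0 : 0 ≤ D := by positivity
  calc _ ≤ ∑ t : ∀ i, I i with ¬ ∀ i, χ i (t i) = 1, (∏ i, ‖c i (t i)‖) * D := by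
        refine (norm_sum_le _ _).trans (sum_le_sum fun t ht => ?_)
        rw [norm_mul, norm_prod]
        refine mul_le_mul_of_nonneg_left ?_ (prod_nonneg fun _ _ => norm_nonneg _)
        refine norm_sum_prod_mulChar_add_le ha (χ := fun i => χ i (t i)) fun h => ?_
        exact (mem_filter.mp ht).2 fun i => congr_fun h i
    _ ≤ ∑ t : ∀ i, I i, (∏ i, ‖c i (t i)‖) * D :=
        sum_le_sum_of_subset_of_nonneg (filter_subset _ _) fun t _ _ =>
          mul_nonneg (prod_nonneg fun _ _ => norm_nonneg _) hD0
    _ = D * ∏ i, ∑ j, ‖c i j‖ := by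
        rw [← sum_mul, mul_comm, prod_univ_sum, Fintype.piFinset_univ]
    _ ≤ D * ∏ i, B i := by
        refine mul_le_mul_of_nonneg_left ?_ hD0
        exact prod_le_prod (fun i _ => sum_nonneg fun _ _ => norm_nonneg _) fun i _ => hB i

end MulCharExpansion

section Sieve

variable {F : Type*} [Field F]

open Classical in
/-- The indicator function of the nonzero elements. -/
noncomputable def nonzeroIndicator (x : F) : ℝ := if x = 0 then 0 else 1

open Classical in
/-- The indicator function of the `l`-th power nonresidues, normalized to have mean `1`. -/
noncomputable def nonresidueWeight [Fintype F] (l : ℕ) (x : F) : ℝ :=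
  if x ^ ((Fintype.card F - 1) / l) = 1 then 0 else l / (l - 1)

theorem nonresidueWeight_nonneg [Fintype F] {l : ℕ} (hl : 1 < l) (x : F) :
    0 ≤ nonresidueWeight l x := by
  have : (1 : ℝ) < l := by exact_mod_cast hl
  rw [nonresidueWeight]
  split_ifs
  · exact le_rfl
  · exact div_nonneg (by positivity) (by linarith)

/-- The indicator function of the elements which are `l`-th power nonresidues for all `l ∈ T`,
normalized to have mean `1` over the nonzero elements. -/
noncomputable def nonresidueWeights [Fintype F] (T : Finset ℕ) (x : F) : ℝ :=
  nonzeroIndicator x * ∏ l ∈ T, nonresidueWeight l x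

theorem mulCharExpansion_nonzeroIndicator :
    MulCharExpansion (fun x : F => (nonzeroIndicator x : ℂ)) 1 1 1 := by
  classical
  refine MulCharExpansion.iff_sum_filter.mpr
    ⟨Unit, inferInstance, fun _ => 1, fun _ => 1, ?_, ?_, ?_, ?_⟩
  · intro x
    rcases eq_or_ne x 0 with rfl | hx
    · simp [nonzeroIndicator, MulChar.map_nonunit (1 : MulChar F ℂ) not_isUnit_zero]
    · simp [nonzeroIndicator, hx, MulChar.one_apply (isUnit_iff_ne_zero.mpr hx)]
  · simp
  · simp [filter_true]
  · simp

theorem MulChar.eq_one_of_apply_eq_one [Fintype F] {ψ : MulChar F ℂ}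
    (hψ : orderOf ψ = Fintype.card F - 1) {y : F} (hy : ψ y = 1) : y = 1 := by
  by_contra hne
  obtain ⟨χ, hχ⟩ := MulChar.exists_apply_ne_one_of_hasEnoughRootsOfUnity F ℂ hne
  obtain ⟨e, he, rfl⟩ := MulChar.exists_pow_eq_of_orderOf_eq_card hψ χ
  exact hχ (by rw [MulChar.pow_apply' _ he.ne', hy, one_pow])

theorem mulCharExpansion_nonresidueWeight_sub_one [Fintype F] {l : ℕ} (hl : l.Prime)
    (hlq : l ∣ Fintype.card F - 1) :
    MulCharExpansion
      (fun x : F => ((nonzeroIndicator x * (nonresidueWeight l x - 1) : ℝ) : ℂ)) l 0 1 := by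
  classical
  obtain ⟨ψ, hψ⟩ := MulChar.exists_orderOf_eq_card_sub_one F
  have hq0 : 0 < Fintype.card F - 1 := by
    have := Fintype.one_lt_card (α := F)
    lia
  set m := (Fintype.card F - 1) / l with hm
  have hml : m * l = Fintype.card F - 1 := Nat.div_mul_cancel hlq
  have hm0 : 0 < m := Nat.div_pos (Nat.le_of_dvd hq0 hlq) hl.pos
  have hl1 : ((l : ℂ) - 1) ≠ 0 := by
    rw [sub_ne_zero]
    exact_mod_cast hl.one_lt.ne'
  set θ := ψ ^ m with hθ
  have hθl : θ ^ l = 1 := by rw [hθ, ← pow_mul, hml, ← hψ, pow_orderOf_eq_one]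
  have hθx : ∀ x, θ x = 1 ↔ x ^ m = 1 := by
    intro x
    rw [hθ, MulChar.pow_apply' _ hm0.ne', ← map_pow]
    exact ⟨MulChar.eq_one_of_apply_eq_one hψ, fun h => by rw [h, map_one]⟩
  have hθne : ∀ i, 0 < i → i < l → θ ^ i ≠ 1 := by
    intro i hi hil h
    rw [hθ, ← pow_mul] at h
    have h1 := Nat.le_of_dvd (Nat.mul_pos hm0 hi) (orderOf_dvd_of_pow_eq_one h)
    rw [hψ, ← hml] at h1
    exact absurd (Nat.le_of_mul_le_mul_left h1 hm0) (by lia)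
  refine MulCharExpansion.iff_sum_filter.mpr
    ⟨Fin (l - 1), inferInstance, fun _ => -1 / (l - 1), fun i => θ ^ (i.val + 1), ?_, ?_, ?_, ?_⟩
  · intro x
    rw [← mul_sum]
    simp only [MulChar.pow_apply' _ (Nat.succ_ne_zero _)]
    rw [Fin.sum_univ_eq_sum_range (fun i => θ x ^ (i + 1)) (l - 1)]
    rcases eq_or_ne x 0 with rfl | hx
    · simp [nonzeroIndicator, MulChar.map_nonunit θ not_isUnit_zero]
    · rw [nonzeroIndicator, if_neg hx, one_mul, nonresidueWeight, ← hm]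
      have hgeom : ∑ i ∈ range (l - 1), θ x ^ (i + 1) = ∑ i ∈ range l, θ x ^ i - 1 := by
        conv_rhs => rw [← Nat.sub_add_cancel hl.pos, sum_range_succ']
        simp
      rw [hgeom]
      split_ifs with h
      · simp only [(hθx x).mpr h, one_pow, sum_const, card_range, nsmul_one]
        push_cast
        field_simp
        ring
      · have h1 : θ x ≠ 1 := fun h' => h ((hθx x).mp h')
        have h2 : θ x ^ l = 1 := by
          rw [← MulChar.pow_apply' _ hl.ne_zero, hθl]
          exact MulChar.one_apply (isUnit_iff_ne_zero.mpr hx)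
        rw [geom_sum_eq h1, h2]
        push_cast
        field_simp
        ring
  · intro i
    rw [← pow_mul, mul_comm, pow_mul, hθl, one_pow]
  · refine sum_eq_zero fun i hi => ?_
    simp only [mem_filter, mem_univ, true_and] at hi
    refine absurd hi ?_
    exact hθne _ (Nat.succ_pos _) (by have := i.2; lia)
  · have h1 : (1 : ℝ) < l := by exact_mod_cast hl.one_lt
    have h2 : ‖(-1 / (l - 1) : ℂ)‖ = 1 / (l - 1) := by
      have : (-1 / (l - 1) : ℂ) = ((-1 / (l - 1) : ℝ) : ℂ) := by push_cast; rfl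
      rw [this, Complex.norm_real, neg_div, norm_neg, Real.norm_of_nonneg]
      exact div_nonneg zero_le_one (by linarith)
    simp only [h2, sum_const, card_univ, Fintype.card_fin, nsmul_eq_mul, Nat.cast_sub hl.pos,
      Nat.cast_one]
    rw [mul_one_div_cancel (by linarith)]

theorem nonzeroIndicator_mul_self (x : F) :
    nonzeroIndicator x * nonzeroIndicator x = nonzeroIndicator x := by
  unfold nonzeroIndicator
  split_ifs <;> simp

theorem MulCharExpansion.mono_of_dvd {φ : F → ℂ} {N M : ℕ} {A : ℂ} {B : ℝ}
    (h : MulCharExpansion φ N A B) (hNM : N ∣ M) : MulCharExpansion φ M A B := by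
  obtain ⟨I, hI, c, χ, hφ, hχ, hAB⟩ := h
  obtain ⟨d, rfl⟩ := hNM
  exact ⟨I, hI, c, χ, hφ, fun i => by rw [pow_mul, hχ, one_pow], hAB⟩

theorem mulCharExpansion_nonresidueWeights [Fintype F] {T : Finset ℕ}
    (hT : ∀ l ∈ T, l.Prime ∧ l ∣ Fintype.card F - 1) :
    MulCharExpansion (fun x : F => (nonresidueWeights T x : ℂ)) (∏ l ∈ T, l) 1 (2 ^ T.card) := by
  classical
  induction T using Finset.induction_on with
  | empty => simpa [nonresidueWeights] using mulCharExpansion_nonzeroIndicator (F := F)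
  | insert l T hl ih =>
    have hlp := hT l (mem_insert_self l T)
    have h1 := ih fun l' hl' => hT l' (mem_insert_of_mem hl')
    have h2 := (mulCharExpansion_nonzeroIndicator.mono_of_dvd (one_dvd l)).add
      (mulCharExpansion_nonresidueWeight_sub_one (F := F) hlp.1 hlp.2)
    have h3 := h2.mul h1 (Nat.Coprime.prod_right fun l' hl' =>
      (Nat.coprime_primes hlp.1 (hT l' (mem_insert_of_mem hl')).1).mpr
        fun h => hl (h ▸ hl'))
    rw [prod_insert hl, card_insert_of_notMem hl, pow_succ']
    convert h3 using 2
    · rename_i x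
      have h4 := nonzeroIndicator_mul_self x
      simp only [nonresidueWeights, prod_insert hl]
      norm_cast
      linear_combination -(∏ l ∈ T, nonresidueWeight l x) * nonresidueWeight l x * h4
    · norm_num
    · norm_num

theorem nonresidueWeights_nonneg [Fintype F] {T : Finset ℕ} (hT : ∀ l ∈ T, l.Prime) (x : F) :
    0 ≤ nonresidueWeights T x := by
  refine mul_nonneg ?_ (prod_nonneg fun l hl => nonresidueWeight_nonneg (hT l hl).one_lt x)
  unfold nonzeroIndicator
  split_ifs <;> norm_num

variable [Fintype F] {ι : Type*} [Fintype ι] {a : ι → F}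

theorem abs_sum_prod_nonresidueWeights_sub_le (ha : Function.Injective a) {T : Finset ℕ}
    (hT : ∀ l ∈ T, l.Prime ∧ l ∣ Fintype.card F - 1) :
    |∑ x, ∏ i, nonresidueWeights T (a i + x) - (Fintype.card F - Fintype.card ι)| ≤
      (Fintype.card ι - 1 : ℕ) * √(Fintype.card F) * (2 ^ T.card) ^ Fintype.card ι := by
  classical
  have h := MulCharExpansion.norm_sum_prod_sub_le ha
    fun _ => mulCharExpansion_nonresidueWeights (F := F) hT
  rw [prod_const_one, one_mul, prod_const, card_univ] at h
  rw [← Real.norm_eq_abs, ← Complex.norm_real]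
  push_cast
  exact h

theorem abs_sum_mul_prod_nonresidueWeights_le (ha : Function.Injective a) {T : Finset ℕ}
    (hT : ∀ l ∈ T, l.Prime ∧ l ∣ Fintype.card F - 1) {l : ℕ} (hl : l.Prime)
    (hlq : l ∣ Fintype.card F - 1) (hlT : l ∉ T) (i : ι) :
    |∑ x, nonzeroIndicator (a i + x) * (nonresidueWeight l (a i + x) - 1) *
        ∏ j, nonresidueWeights T (a j + x)| ≤
      (Fintype.card ι - 1 : ℕ) * √(Fintype.card F) * (2 ^ T.card) ^ Fintype.card ι := by
  classical
  have h1 := mulCharExpansion_nonresidueWeights (F := F) hT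
  have h2 := (mulCharExpansion_nonresidueWeight_sub_one (F := F) hl hlq).mul h1
    (Nat.Coprime.prod_right fun l' hl' =>
      (Nat.coprime_primes hl (hT l' hl').1).mpr fun h => hlT (h ▸ hl'))
  have h := MulCharExpansion.norm_sum_prod_sub_le ha
    (φ := fun j x => (if j = i then
      ((nonzeroIndicator x * (nonresidueWeight l x - 1) : ℝ) : ℂ) else 1) *
        (nonresidueWeights T x : ℂ))
    (N := fun j => if j = i then l * ∏ l ∈ T, l else ∏ l ∈ T, l)
    (A := fun j => if j = i then 0 * 1 else 1) (B := fun _ => 2 ^ T.card) (by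
      intro j
      by_cases hj : j = i
      · simpa only [hj, if_true, one_mul] using h2
      · simpa only [hj, if_false, one_mul] using h1)
  have h3 : ∏ j : ι, (if j = i then (0 : ℂ) * 1 else 1) = 0 :=
    prod_eq_zero (mem_univ i) (by simp)
  rw [h3, zero_mul, sub_zero, prod_const, card_univ] at h
  rw [← Real.norm_eq_abs, ← Complex.norm_real]
  convert h using 2
  push_cast
  refine sum_congr rfl fun x _ => ?_
  rw [prod_mul_distrib, prod_ite_eq' univ i]
  simp

/-- The sieve inequality: `T` collects the primes treated exactly, `R` the sieving primes. -/
theorem exists_forall_pow_ne_one (ha : Function.Injective a) {T R : Finset ℕ}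
    (hT : ∀ l ∈ T, l.Prime ∧ l ∣ Fintype.card F - 1)
    (hR : ∀ l ∈ R, l.Prime ∧ l ∣ Fintype.card F - 1) (hTR : Disjoint T R) {δ : ℝ} (hδ : 0 < δ)
    (hδR : δ = 1 - Fintype.card ι * ∑ l ∈ R, (1 / l : ℝ))
    (h : (Fintype.card ι - 1 : ℕ) * √(Fintype.card F) * (2 ^ T.card) ^ Fintype.card ι *
      (Fintype.card ι * R.card - 1 + 2 * δ) < δ * (Fintype.card F - Fintype.card ι)) :
    ∃ x, ∀ i, a i + x ≠ 0 ∧ ∀ l ∈ T ∪ R, (a i + x) ^ ((Fintype.card F - 1) / l) ≠ 1 := by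
  classical
  by_contra! hcon
  set D : ℝ := (Fintype.card ι - 1 : ℕ) * √(Fintype.card F) * (2 ^ T.card) ^ Fintype.card ι
  set P : F → ℝ := fun x => ∏ i, nonresidueWeights T (a i + x) with hP
  set v : ℕ → F → ℝ := fun l y => nonzeroIndicator y * (nonresidueWeight l y - 1) with hv
  have hM := abs_sum_prod_nonresidueWeights_sub_le ha hT
  have hE : ∀ i, ∀ l ∈ R, |∑ x, v l (a i + x) * P x| ≤ D := fun i l hl =>
    abs_sum_mul_prod_nonresidueWeights_le ha hT (hR l hl).1 (hR l hl).2
      (Finset.disjoint_right.mp hTR hl) i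
  have hpt : ∀ x, P x * (1 - ∑ i, ∑ l ∈ R, (1 / l - (1 - 1 / l) * v l (a i + x))) ≤ 0 := by
    intro x
    rcases eq_or_ne (P x) 0 with h0 | h0
    · rw [h0, zero_mul]
    have hne : ∀ i, a i + x ≠ 0 := by
      intro i hi
      refine h0 (prod_eq_zero (mem_univ i) ?_)
      simp [nonresidueWeights, nonzeroIndicator, hi]
    have hterm : ∀ i, ∀ l ∈ R, (1 / l - (1 - 1 / l) * v l (a i + x) : ℝ) =
        if (a i + x) ^ ((Fintype.card F - 1) / l) = 1 then 1 else 0 := by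
      intro i l hl
      have hl1 : (1 : ℝ) < l := by exact_mod_cast (hR l hl).1.one_lt
      have hl2 : (l : ℝ) - 1 ≠ 0 := by linarith
      have hl3 : (l : ℝ) ≠ 0 := by linarith
      simp only [hv, nonzeroIndicator, if_neg (hne i), nonresidueWeight]
      split_ifs
      · ring
      · field_simp
        ring
    have hnn : ∀ i, ∀ l ∈ R, (0 : ℝ) ≤ 1 / l - (1 - 1 / l) * v l (a i + x) := by
      intro i l hl
      rw [hterm i l hl]
      split_ifs <;> norm_num
    obtain ⟨i, hi⟩ := hcon x
    obtain ⟨l, hl, hl1⟩ := hi (hne i)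
    have hlR : l ∈ R := by
      refine (mem_union.mp hl).resolve_left fun hlT => h0 (prod_eq_zero (mem_univ i) ?_)
      refine mul_eq_zero_of_right _ (prod_eq_zero hlT ?_)
      rw [nonresidueWeight, if_pos hl1]
    refine mul_nonpos_of_nonneg_of_nonpos
      (prod_nonneg fun i _ => nonresidueWeights_nonneg (fun l hl => (hT l hl).1) _) ?_
    rw [sub_nonpos]
    calc (1 : ℝ) = 1 / l - (1 - 1 / l) * v l (a i + x) := by rw [hterm i l hlR, if_pos hl1]
      _ ≤ ∑ l ∈ R, (1 / l - (1 - 1 / l) * v l (a i + x)) :=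
          single_le_sum (f := fun l : ℕ => (1 / l - (1 - 1 / l) * v l (a i + x) : ℝ))
            (hnn i) hlR
      _ ≤ ∑ i, ∑ l ∈ R, (1 / l - (1 - 1 / l) * v l (a i + x)) :=
          single_le_sum
            (f := fun i => ∑ l ∈ R, (1 / l - (1 - 1 / l) * v l (a i + x) : ℝ))
            (fun i _ => sum_nonneg (hnn i)) (mem_univ i)
  have hsum : ∑ x, P x * (1 - ∑ i, ∑ l ∈ R, (1 / l - (1 - 1 / l) * v l (a i + x))) =
      δ * ∑ x, P x + ∑ i, ∑ l ∈ R, (1 - 1 / l) * ∑ x, v l (a i + x) * P x := by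
    have h1 : ∀ x, P x * (1 - ∑ i, ∑ l ∈ R, (1 / l - (1 - 1 / l) * v l (a i + x))) =
        δ * P x + ∑ i, ∑ l ∈ R, (1 - 1 / l) * (v l (a i + x) * P x) := by
      intro x
      simp only [sum_sub_distrib, sum_const, card_univ, nsmul_eq_mul, ← mul_assoc, ← sum_mul]
      rw [hδR]
      ring
    simp only [h1, sum_add_distrib, ← mul_sum]
    congr 1
    rw [sum_comm]
    refine sum_congr rfl fun i _ => ?_
    rw [sum_comm]
    simp only [mul_sum]
  have herr : -(D * (Fintype.card ι * R.card - 1 + δ)) ≤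
      ∑ i, ∑ l ∈ R, (1 - 1 / l) * ∑ x, v l (a i + x) * P x := by
    have h1 : -(D * (Fintype.card ι * R.card - 1 + δ)) =
        ∑ _i : ι, ∑ l ∈ R, (1 - 1 / l : ℝ) * -D := by
      simp only [← sum_mul, sum_sub_distrib, sum_const, card_univ, nsmul_eq_mul, mul_one]
      rw [hδR]
      ring
    rw [h1]
    refine sum_le_sum fun i _ => sum_le_sum fun l hl => mul_le_mul_of_nonneg_left
      (neg_le_of_abs_le (hE i l hl)) ?_
    have hl1 : (1 : ℝ) ≤ l := by exact_mod_cast (hR l hl).1.one_le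
    rw [sub_nonneg]
    exact div_le_one_of_le₀ hl1 (by linarith)
  have htot := hsum ▸ sum_nonpos fun x (_ : x ∈ univ) => hpt x
  have hM1 := mul_le_mul_of_nonneg_left (sub_le_of_abs_sub_le_left hM) hδ.le
  nlinarith

end Sieve

theorem isPrimitiveElem_of_forall_pow_ne_one {F : Type*} [Field F] [Fintype F] {g : F}
    (hg : g ≠ 0)
    (h : ∀ l ∈ (Fintype.card F - 1).primeFactors, g ^ ((Fintype.card F - 1) / l) ≠ 1) :
    IsPrimitiveElem g := by
  classical
  have hq : 0 < Fintype.card F - 1 := by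
    have := Fintype.one_lt_card (α := F)
    lia
  set u := Units.mk0 g hg with hu
  have hou : orderOf u = Fintype.card F - 1 := by
    rw [← orderOf_units]
    refine orderOf_eq_of_pow_and_pow_div_prime hq (FiniteField.pow_card_sub_one_eq_one g hg) ?_
    intro l hl hlq
    exact h l (Nat.mem_primeFactors.mpr ⟨hl, hlq, hq.ne'⟩)
  intro x hx
  have htop := (Subgroup.card_eq_iff_eq_top (Subgroup.zpowers u)).mp
    (by rw [Nat.card_zpowers, hou, Nat.card_units, Nat.card_eq_fintype_card])
  obtain ⟨k, hk⟩ := (mem_powers_iff_mem_zpowers (x := u) (y := Units.mk0 x hx)).mpr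
    (htop ▸ Subgroup.mem_top _)
  exact ⟨k, by simpa [hu] using congr_arg Units.val hk⟩

/-- The sieve inequality for four consecutive elements, where `T` collects the primes treated
exactly and `R` the sieving primes. -/
theorem hasConsecutivePrimitives_four_of_disjoint {F : Type*} [Field F] [Fintype F]
    (ha : Function.Injective fun i : Fin 4 => (i.val : F)) {T R : Finset ℕ} (hTR : Disjoint T R)
    (hU : T ∪ R = (Fintype.card F - 1).primeFactors) {K : ℝ}
    (hδ : 4 * ∑ l ∈ R, (1 / l : ℝ) < 1)
    (hK : 4 * R.card - 1 ≤ (K - 2) * (1 - 4 * ∑ l ∈ R, (1 / l : ℝ)))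
    (hq : (3 * 16 ^ T.card * K + 1) ^ 2 ≤ (Fintype.card F : ℝ)) (hq16 : 16 < Fintype.card F) :
    HasConsecutivePrimitives F 4 := by
  have hmem : ∀ l ∈ T ∪ R, l.Prime ∧ l ∣ Fintype.card F - 1 := by
    intro l hl
    rw [hU] at hl
    exact ⟨Nat.prime_of_mem_primeFactors hl, Nat.dvd_of_mem_primeFactors hl⟩
  set δ : ℝ := 1 - 4 * ∑ l ∈ R, (1 / l : ℝ) with hδ'
  have hδ0 : 0 < δ := by linarith
  have hq16' : (16 : ℝ) < Fintype.card F := by exact_mod_cast hq16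
  have hr : 4 < √(Fintype.card F : ℝ) := by
    rw [Real.lt_sqrt (by norm_num)]
    linarith
  have hr2 : √(Fintype.card F : ℝ) * √(Fintype.card F : ℝ) = Fintype.card F :=
    Real.mul_self_sqrt (by linarith)
  have hr3 : 3 * 16 ^ T.card * K + 1 ≤ √(Fintype.card F : ℝ) := Real.le_sqrt_of_sq_le hq
  obtain ⟨x, hx⟩ := exists_forall_pow_ne_one ha (fun l hl => hmem l (mem_union_left R hl))
    (fun l hl => hmem l (mem_union_right T hl)) hTR hδ0 (by rw [Fintype.card_fin]; exact hδ') (by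
      rw [Fintype.card_fin, ← pow_mul, mul_comm T.card, pow_mul]
      norm_num only [Nat.cast_ofNat]
      calc 3 * √(Fintype.card F) * 16 ^ T.card * (4 * R.card - 1 + 2 * δ)
          ≤ 3 * √(Fintype.card F) * 16 ^ T.card * (K * δ) :=
            mul_le_mul_of_nonneg_left (by linarith) (by positivity)
        _ = δ * ((3 * 16 ^ T.card * K) * √(Fintype.card F)) := by ring
        _ < δ * (Fintype.card F - 4) := by
            refine mul_lt_mul_of_pos_left ?_ hδ0
            nlinarith)
  refine ⟨x, fun k hk => ?_, fun i hi j hj hij => ?_⟩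
  · obtain ⟨h1, h2⟩ := hx ⟨k, hk⟩
    rw [add_comm]
    exact isPrimitiveElem_of_forall_pow_ne_one h1 (hU ▸ h2)
  · have := @ha ⟨i, hi⟩ ⟨j, hj⟩ (add_left_cancel hij)
    simpa using this

/-- `n` is a prime number at most `29`, or is at least `31` and has no prime factor at most `29`. -/
def PrimeSieve (n : ℕ) : Prop :=
  n ∈ [2, 3, 5, 7, 11, 13, 17, 19, 23, 29] ∨ 31 ≤ n ∧ n.Coprime 6469693230

instance : DecidablePred PrimeSieve := fun n => by unfold PrimeSieve; infer_instance

theorem Nat.Prime.primeSieve {p : ℕ} (hp : p.Prime) : PrimeSieve p := by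
  rcases lt_or_ge p 31 with h | h
  · revert hp
    revert p
    decide
  · refine Or.inr ⟨h, (Nat.Prime.coprime_iff_not_dvd hp).mpr fun hd => ?_⟩
    have h1 : (6469693230 : ℕ) = 2 * 3 * 5 * 7 * 11 * 13 * 17 * 19 * 23 * 29 := by norm_num
    simp only [h1, hp.dvd_mul] at hd
    have h2 : ∀ n, 0 < n → n < 31 → ¬ p ∣ n := fun n h0 hn hd => by
      have := Nat.le_of_dvd h0 hd
      lia
    simp [h2] at hd

theorem sum_one_div_le_sum_Ico {R : Finset ℕ} {B c : ℕ} (hB : 0 < B)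
    (hR : ∀ p ∈ R, PrimeSieve p ∧ B ≤ p) (hcard : R.card ≤ #{p ∈ Ico B c | PrimeSieve p}) :
    ∑ p ∈ R, (1 / p : ℚ) ≤ ∑ p ∈ Ico B c with PrimeSieve p, (1 / p : ℚ) := by
  set L := {p ∈ Ico B c | PrimeSieve p} with hL
  rw [← sum_sdiff_le_sum_sdiff]
  rw [← card_sdiff_le_card_sdiff_iff] at hcard
  calc ∑ p ∈ R \ L, (1 / p : ℚ) ≤ #(R \ L) * (1 / c : ℚ) := by
        rw [← nsmul_eq_mul]
        refine sum_le_card_nsmul _ _ _ fun p hp => ?_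
        obtain ⟨h1, h2⟩ := mem_sdiff.mp hp
        have h3 : c ≤ p := by
          by_contra! h4
          exact h2 (mem_filter.mpr ⟨mem_Ico.mpr ⟨(hR p h1).2, h4⟩, (hR p h1).1⟩)
        have hc : 0 < c := by
          by_contra! hc
          have hL0 : L = ∅ := by simp [hL, Nat.le_zero.mp hc]
          rw [hL0, sdiff_empty, empty_sdiff, card_empty, Nat.le_zero, card_eq_zero] at hcard
          exact notMem_empty p (hcard ▸ h1)
        exact one_div_le_one_div_of_le (by exact_mod_cast hc) (by exact_mod_cast h3)
    _ ≤ #(L \ R) * (1 / c : ℚ) :=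
        mul_le_mul_of_nonneg_right (by exact_mod_cast hcard) (by positivity)
    _ ≤ ∑ p ∈ L \ R, (1 / p : ℚ) := by
        rw [← nsmul_eq_mul]
        refine card_nsmul_le_sum _ _ _ fun p hp => ?_
        have h1 := mem_Ico.mp (mem_filter.mp (mem_sdiff.mp hp).1).1
        exact one_div_le_one_div_of_le (by exact_mod_cast hB.trans_le h1.1)
          (by exact_mod_cast h1.2.le)

theorem pow_card_mul_prod_le {S : Finset ℕ} {t c : ℕ} (htc : t ≤ c) (hS : ∀ p ∈ S, PrimeSieve p)
    (hcard : #{p ∈ range c | PrimeSieve p} ≤ S.card) :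
    t ^ S.card * ∏ p ∈ range c with PrimeSieve p, p ≤
      t ^ #{p ∈ range c | PrimeSieve p} * ∏ p ∈ S, p := by
  set L := {p ∈ range c | PrimeSieve p} with hL
  rw [← card_sdiff_le_card_sdiff_iff] at hcard
  have h1 : ∏ p ∈ L \ S, p ≤ c ^ #(L \ S) := prod_le_pow_card _ _ _ fun p hp =>
    (mem_range.mp (mem_filter.mp (mem_sdiff.mp hp).1).1).le
  have h2 : c ^ #(S \ L) ≤ ∏ p ∈ S \ L, p := pow_card_le_prod _ _ _ fun p hp => by
    obtain ⟨h3, h4⟩ := mem_sdiff.mp hp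
    by_contra! h5
    exact h4 (mem_filter.mpr ⟨mem_range.mpr h5, hS p h3⟩)
  obtain ⟨d, hd⟩ := Nat.exists_eq_add_of_le hcard
  rw [← prod_inter_mul_prod_sdiff L S, ← prod_inter_mul_prod_sdiff S L, inter_comm L S,
    ← card_inter_add_card_sdiff S L, ← card_inter_add_card_sdiff L S, inter_comm L S, hd]
  calc t ^ (#(S ∩ L) + (#(L \ S) + d)) * ((∏ p ∈ S ∩ L, p) * ∏ p ∈ L \ S, p)
      ≤ t ^ (#(S ∩ L) + (#(L \ S) + d)) * ((∏ p ∈ S ∩ L, p) * c ^ #(L \ S)) := by gcongr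
    _ = t ^ (#(S ∩ L) + #(L \ S)) * ((∏ p ∈ S ∩ L, p) * (c ^ #(L \ S) * t ^ d)) := by ring
    _ ≤ t ^ (#(S ∩ L) + #(L \ S)) * ((∏ p ∈ S ∩ L, p) * (c ^ #(L \ S) * c ^ d)) := by gcongr
    _ ≤ t ^ (#(S ∩ L) + #(L \ S)) * ((∏ p ∈ S ∩ L, p) * ∏ p ∈ S \ L, p) := by
        rw [← pow_add, ← hd]
        gcongr

theorem prod_primeFactors_lt {n : ℕ} (hn : 1 < n) : ∏ p ∈ (n - 1).primeFactors, p < n :=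
  lt_of_le_of_lt (Nat.le_of_dvd (by lia) (Nat.prod_primeFactors_dvd _)) (by lia)

theorem prod_lt_of_card_le {n c : ℕ} (hn : 1 < n)
    (hcard : #{p ∈ range c | PrimeSieve p} ≤ (n - 1).primeFactors.card) :
    ∏ p ∈ range c with PrimeSieve p, p < n := by
  rcases Nat.eq_zero_or_pos c with rfl | hc
  · simpa using hn
  have h := pow_card_mul_prod_le (t := 1) hc
    (fun p hp => (Nat.prime_of_mem_primeFactors hp).primeSieve) hcard
  rw [one_pow, one_pow, one_mul, one_mul] at h
  exact h.trans_lt (prod_primeFactors_lt hn)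

theorem six_mul_sixteen_pow_add_one_sq_le (w : ℕ) : (6 * 16 ^ w + 1) ^ 2 ≤ 49 * 256 ^ w := by
  have h1 : 256 ^ w = 16 ^ w * 16 ^ w := by
    rw [← mul_pow]
    norm_num only
  have h2 : 1 ≤ 16 ^ w := Nat.one_le_pow _ _ (by norm_num)
  rw [h1]
  nlinarith

theorem hasConsecutivePrimitives_four_of_card_primeFactors_le {F : Type*} [Field F] [Fintype F]
    (ha : Function.Injective fun i : Fin 4 => (i.val : F)) (B c w s : ℕ) (K : ℚ) (hB : 0 < B)
    (hw : #{p ∈ range B | PrimeSieve p} ≤ w) (hs : s ≤ #{p ∈ Ico B c | PrimeSieve p})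
    (hω : (Fintype.card F - 1).primeFactors.card ≤ w + s) (hK0 : 2 ≤ K)
    (hδ : 4 * ∑ p ∈ Ico B c with PrimeSieve p, (1 / p : ℚ) < 1)
    (hK : 4 * s - 1 ≤ (K - 2) * (1 - 4 * ∑ p ∈ Ico B c with PrimeSieve p, (1 / p : ℚ)))
    (hq : (3 * 16 ^ w * K + 1) ^ 2 ≤ (Fintype.card F : ℚ)) (hq16 : 16 < Fintype.card F) :
    HasConsecutivePrimitives F 4 := by
  classical
  set S := (Fintype.card F - 1).primeFactors with hS
  have hSp : ∀ p ∈ S, PrimeSieve p := fun p hp => (Nat.prime_of_mem_primeFactors hp).primeSieve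
  obtain ⟨T, hT1, hT2, hTw⟩ := exists_subsuperset_card_eq (s := {p ∈ S | p < B}) (t := S)
    (n := min w S.card) (filter_subset _ _)
    (le_min ((card_le_card fun p hp => by
      obtain ⟨h1, h2⟩ := mem_filter.mp hp
      exact mem_filter.mpr ⟨mem_range.mpr h2, hSp p h1⟩).trans hw)
      (card_le_card (filter_subset _ _))) (min_le_right _ _)
  have hRB : ∀ p ∈ S \ T, PrimeSieve p ∧ B ≤ p := fun p hp => by
    obtain ⟨h1, h2⟩ := mem_sdiff.mp hp
    refine ⟨hSp p h1, ?_⟩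
    by_contra! h3
    exact h2 (hT1 (mem_filter.mpr ⟨h1, h3⟩))
  have hRs : #(S \ T) ≤ s := by
    rw [card_sdiff_of_subset hT2]
    lia
  have hsum := sum_one_div_le_sum_Ico hB hRB (hRs.trans hs)
  set σ := ∑ p ∈ Ico B c with PrimeSieve p, (1 / p : ℚ)
  have hcast : ∑ p ∈ S \ T, (1 / p : ℝ) = ((∑ p ∈ S \ T, (1 / p : ℚ) : ℚ) : ℝ) := by
    push_cast
    rfl
  have hRs' : (#(S \ T) : ℚ) ≤ s := by exact_mod_cast hRs
  refine hasConsecutivePrimitives_four_of_disjoint ha (T := T) (R := S \ T) (K := K)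
    disjoint_sdiff (union_sdiff_of_subset hT2) ?_ ?_ ?_
    hq16
  · rw [hcast]
    exact_mod_cast (show 4 * ∑ p ∈ S \ T, (1 / p : ℚ) < 1 by linarith)
  · rw [hcast]
    have : (4 * #(S \ T) - 1 : ℚ) ≤ (K - 2) * (1 - 4 * ∑ p ∈ S \ T, (1 / p : ℚ)) := by
      nlinarith
    exact_mod_cast this
  · have hTw' : T.card ≤ w := hTw.trans_le (min_le_left _ _)
    have : (3 * 16 ^ T.card * K + 1) ^ 2 ≤ (Fintype.card F : ℚ) := by
      refine le_trans ?_ hq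
      have : 0 ≤ K := by linarith
      gcongr
      norm_num
    exact_mod_cast this

theorem injective_fin_four_natCast {F : Type*} [Field F] {p : ℕ} (hp : CharP F p) (hp4 : 4 ≤ p) :
    Function.Injective fun i : Fin 4 => (i.val : F) := fun i j hij => by
  have h := (CharP.natCast_eq_natCast F p).mp hij
  exact Fin.ext (Nat.ModEq.eq_of_lt_of_lt h (by lia) (by lia))

/-- For `q` a prime power of characteristic `p ≥ 4` with `q > 3.29 × 10^{32}`,
the field `𝔽_q` contains `4` consecutive primitive elements. -/
theorem four_consecutive_primitives (q p : ℕ) (hq : IsPrimePow q)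
    (F : Type*) [Field F] [Fintype F] (hF : Fintype.card F = q) (hp : CharP F p)
    (hp4 : 4 ≤ p) (hbig : (q : ℝ) > 3.29 * 10 ^ 32) : HasConsecutivePrimitives F 4 := by
  subst hF
  have ha := injective_fin_four_natCast hp hp4
  have hbig' : 329 * 10 ^ 30 < Fintype.card F := by
    have : ((329 * 10 ^ 30 : ℕ) : ℝ) < Fintype.card F := by
      push_cast
      linarith
    exact_mod_cast this
  have hq1 : 1 < Fintype.card F := by lia
  have hq16 : 16 < Fintype.card F := by lia
  have hprod : ∀ c {x : ℚ}, #{p ∈ range c | PrimeSieve p} ≤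
      (Fintype.card F - 1).primeFactors.card →
      x ≤ ((∏ p ∈ range c with PrimeSieve p, p : ℕ) : ℚ) → x ≤ (Fintype.card F : ℚ) :=
    fun c x hc hx => hx.trans (by exact_mod_cast (prod_lt_of_card_le hq1 hc).le)
  have hblock := hasConsecutivePrimitives_four_of_card_primeFactors_le ha
  have hc97 : #{p ∈ range 97 | PrimeSieve p} = 24 := by decide +kernel
  have hc103 : #{p ∈ range 103 | PrimeSieve p} = 26 := by decide +kernel
  have hc131 : #{p ∈ range 131 | PrimeSieve p} = 31 := by decide +kernel
  have hc197 : #{p ∈ range 197 | PrimeSieve p} = 44 := by decide +kernel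
  have hc457 : #{p ∈ range 457 | PrimeSieve p} = 87 := by decide +kernel
  have hc887 : #{p ∈ range 887 | PrimeSieve p} = 153 := by decide +kernel
  rcases le_or_gt (Fintype.card F - 1).primeFactors.card 23 with h | h
  · refine hblock 37 89 11 12 343.4 (by norm_num) (by decide +kernel) (by decide +kernel) h
      (by norm_num) (by decide +kernel) (by decide +kernel) ?_ hq16
    have : (329 * 10 ^ 30 : ℚ) < Fintype.card F := by exact_mod_cast hbig'
    linarith
  rcases le_or_gt (Fintype.card F - 1).primeFactors.card 25 with h' | h'
  · exact hblock 37 101 11 14 1070 (by norm_num) (by decide +kernel) (by decide +kernel) h'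
      (by norm_num) (by decide +kernel) (by decide +kernel)
      (hprod 97 (hc97.trans_le h) (by decide +kernel)) hq16
  clear h
  rcases le_or_gt (Fintype.card F - 1).primeFactors.card 30 with h | h
  · exact hblock 43 127 13 17 970 (by norm_num) (by decide +kernel) (by decide +kernel) h
      (by norm_num) (by decide +kernel) (by decide +kernel)
      (hprod 103 (hc103.trans_le h') (by decide +kernel)) hq16
  clear h'
  rcases le_or_gt (Fintype.card F - 1).primeFactors.card 43 with h' | h'
  · exact hblock 61 193 17 26 1880 (by norm_num) (by decide +kernel) (by decide +kernel) h'
      (by norm_num) (by decide +kernel) (by decide +kernel)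
      (hprod 131 (hc131.trans_le h) (by decide +kernel)) hq16
  clear h
  rcases le_or_gt (Fintype.card F - 1).primeFactors.card 86 with h | h
  · exact hblock 109 449 28 58 13983 (by norm_num) (by decide +kernel) (by decide +kernel) h
      (by norm_num) (by decide +kernel) (by decide +kernel)
      (hprod 197 (hc197.trans_le h') (by decide +kernel)) hq16
  clear h'
  rcases le_or_gt (Fintype.card F - 1).primeFactors.card 152 with h' | h'
  · exact hblock 367 883 72 80 715 (by norm_num) (by decide +kernel) (by decide +kernel) h'
      (by norm_num) (by decide +kernel) (by decide +kernel)
      (hprod 457 (hc457.trans_le h) (by decide +kernel)) hq16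
  clear h
  refine hasConsecutivePrimitives_four_of_disjoint ha (T := (Fintype.card F - 1).primeFactors)
    (R := ∅) (K := 2) (disjoint_empty_right _) (union_empty _) (by simp) (by simp) ?_ hq16
  have h1 := pow_card_mul_prod_le (t := 256) (c := 887) (by norm_num)
    (fun p hp => (Nat.prime_of_mem_primeFactors hp).primeSieve) (hc887.trans_le h')
  have h2 : 49 * 256 ^ 153 ≤ ∏ p ∈ range 887 with PrimeSieve p, p := by decide +kernel
  rw [hc887] at h1
  set w := (Fintype.card F - 1).primeFactors.card
  have h3 : 49 * 256 ^ w ≤ Fintype.card F := by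
    refine le_trans ?_ (prod_primeFactors_lt hq1).le
    refine Nat.le_of_mul_le_mul_left (le_trans ?_ h1) (by positivity : 0 < 256 ^ 153)
    calc 256 ^ 153 * (49 * 256 ^ w) = 256 ^ w * (49 * 256 ^ 153) := by ring
      _ ≤ _ := Nat.mul_le_mul_left _ h2
  calc (3 * 16 ^ w * 2 + 1 : ℝ) ^ 2 = (((6 * 16 ^ w + 1) ^ 2 : ℕ) : ℝ) := by
        push_cast
        ring
    _ ≤ Fintype.card F := by exact_mod_cast (six_mul_sixteen_pow_add_one_sq_le w).trans h3
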